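/- arXiv:0904.3355 — 3 statements merged into one kernel-verified Lean document; each statement's English description precedes it below -/
import Mathlib

section
/- Let k be a σδ-field of characteristic 0 with σδ = δσ, such that the field of σ-constants C_k is relatively algebraically closed in k (D_k = C_k). Let L = k⟨X, det(X)⁻¹⟩ with σ(X) = AX for A ∈ GL_m(k). Then the ring R = kC_L{X, det(X)⁻¹} is a simple σ-ring. -/
namespace DifferenceRing

open scoped TensorProduct

section TensorMaps

variable {K A B D : Type*} [CommRing K] [CommRing A] [CommRing B] [CommRing D]
  [Algebra K A] [Algebra K B]

/-- The ring homomorphism out of `A ⊗[K] B` induced by two ring homomorphisms that agree on `K`. -/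
noncomputable def tensorLift (f : A →+* D) (g : B →+* D)
    (h : ∀ c : K, f (algebraMap K A c) = g (algebraMap K B c)) : A ⊗[K] B →+* D :=
  letI : Algebra K D := (f.comp (algebraMap K A)).toAlgebra
  (Algebra.TensorProduct.lift (S := K) (⟨f, fun _ => rfl⟩ : A →ₐ[K] D)
    (⟨g, fun c => (h c).symm⟩ : B →ₐ[K] D) (fun _ _ => Commute.all _ _)).toRingHom

@[simp]
theorem tensorLift_tmul (f : A →+* D) (g : B →+* D)
    (h : ∀ c : K, f (algebraMap K A c) = g (algebraMap K B c)) (a : A) (b : B) :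
    tensorLift f g h (a ⊗ₜ[K] b) = f a * g b :=
  rfl

/-- The tensor product of two ring endomorphisms lying over the same endomorphism of `K`. -/
noncomputable def tensorMap (s : K →+* K) (f : A →+* A) (g : B →+* B)
    (hf : ∀ c, f (algebraMap K A c) = algebraMap K A (s c))
    (hg : ∀ c, g (algebraMap K B c) = algebraMap K B (s c)) : A ⊗[K] B →+* A ⊗[K] B :=
  tensorLift (Algebra.TensorProduct.includeLeftRingHom.comp f)
    (Algebra.TensorProduct.includeRight.toRingHom.comp g) (fun c => by
      simp only [RingHom.comp_apply, hf, hg]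
      exact Algebra.TensorProduct.tmul_one_eq_one_tmul (s c))

@[simp]
theorem tensorMap_tmul (s : K →+* K) (f : A →+* A) (g : B →+* B)
    (hf : ∀ c, f (algebraMap K A c) = algebraMap K A (s c))
    (hg : ∀ c, g (algebraMap K B c) = algebraMap K B (s c)) (a : A) (b : B) :
    tensorMap s f g hf hg (a ⊗ₜ[K] b) = f a ⊗ₜ[K] g b := by
  simp [tensorMap]

end TensorMaps

/-- The `R`-subalgebra of `R ⊗[K] R` generated by the constants. -/
noncomputable def constantSpan {K R : Type*} [CommRing K] [CommRing R] [Algebra K R]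
    (σK : K →+* K) (σR : R →+* R)
    (hKR : ∀ c, σR (algebraMap K R c) = algebraMap K R (σK c)) : Subalgebra R (R ⊗[K] R) :=
  Algebra.adjoin R {e | tensorMap σK σR σR hKR hKR e = e}

/-- A family of scalars that is linearly independent over the fixed field annihilates only the zero
family of constants. -/
theorem eq_zero_of_sum_smul_eq_zero {ι L V : Type*} [Field L] [AddCommGroup V] [Module L V]
    (σ : L →+* L) (τ : V →+ V) (hτ : ∀ (a : L) v, τ (a • v) = σ a • τ v)
    (e : ι → V) (he : ∀ i, τ (e i) = e i) (s : Finset ι) (a : ι → L)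
    (ha : ∀ c : ι → L, (∀ i, σ (c i) = c i) → ∑ i ∈ s, c i * a i = 0 → ∀ i ∈ s, c i = 0)
    (h : ∑ i ∈ s, a i • e i = 0) : ∀ i ∈ s, e i = 0 := by
  classical
  induction s using Finset.induction generalizing a with
  | empty => simp
  | insert i₀ s hi₀ ih =>
    have ha₀ : a i₀ ≠ 0 := by
      intro h0
      have := ha (Pi.single i₀ 1) (fun i => by
        by_cases hi : i = i₀
        · subst hi; simp
        · simp [hi]) (by
          rw [Finset.sum_insert hi₀, h0, mul_zero, zero_add]
          refine Finset.sum_eq_zero fun i hi => ?_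
          have : i ≠ i₀ := fun h => hi₀ (h ▸ hi)
          simp [this]) i₀ (Finset.mem_insert_self _ _)
      simp at this
    have h' : e i₀ + ∑ i ∈ s, (a i / a i₀) • e i = 0 := by
      have := congrArg (fun v => (a i₀)⁻¹ • v) h
      rw [Finset.sum_insert hi₀] at this
      simpa [smul_add, Finset.smul_sum, smul_smul, ha₀, div_eq_inv_mul] using this
    have h'' : ∑ i ∈ s, (σ (a i / a i₀) - a i / a i₀) • e i = 0 := by
      have := congrArg τ h'
      simp only [map_add, map_sum, hτ, he, map_zero] at this
      simp only [sub_smul, Finset.sum_sub_distrib]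
      rw [← add_sub_add_left_eq_sub _ _ (e i₀), this, h', sub_zero]
    have hs := ih _ (fun c hc hsum i hi => by
      set d : L := ∑ i ∈ s, c i * (a i / a i₀) with hd
      have hdσ : σ d = d := by
        rw [← sub_eq_zero, hd, map_sum, ← Finset.sum_sub_distrib, ← hsum]
        refine Finset.sum_congr rfl fun j _ => ?_
        rw [map_mul, hc, mul_sub]
      have := ha (fun j => if j = i₀ then -d else c j) (fun j => by
        split_ifs
        · rw [map_neg, hdσ]
        · exact hc j) (by
          rw [Finset.sum_insert hi₀, if_pos rfl]
          have : ∑ j ∈ s, (if j = i₀ then -d else c j) * a j = d * a i₀ := by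
            rw [hd, Finset.sum_mul]
            refine Finset.sum_congr rfl fun j hj => ?_
            rw [if_neg (fun h : j = i₀ => hi₀ (h ▸ hj)), mul_assoc, div_mul_cancel₀ _ ha₀]
          rw [this]; ring) i (Finset.mem_insert_of_mem hi)
      rwa [if_neg (fun h : i = i₀ => hi₀ (h ▸ hi))] at this) h''
    intro i hi
    rcases Finset.mem_insert.1 hi with rfl | hi
    · rw [Finset.sum_eq_zero fun j hj => by rw [hs j hj, smul_zero], add_zero] at h'
      exact h'
    · exact hs i hi

section Simple

variable {C K R L : Type*} [Field C] [Field K] [CommRing R] [Field L] [Algebra C R] [Algebra K R]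
  [Algebra R L] [Algebra C L] [Algebra K L] [IsScalarTower C R L] [IsScalarTower K R L]

theorem exists_basis_expansion {ι : Type*} (b : Module.Basis ι C R) (σK : K →+* K) (σR : R →+* R)
    (hKR : ∀ c, σR (algebraMap K R c) = algebraMap K R (σK c))
    (hC : ∀ c, σR (algebraMap C R c) = algebraMap C R c) {x : R ⊗[K] R}
    (hx : x ∈ constantSpan σK σR hKR) :
    ∃ g : ι →₀ R ⊗[K] R, (∀ j, tensorMap σK σR σR hKR hKR (g j) = g j) ∧
      x = g.sum fun j e => b j • e := by
  classical
  set τ := tensorMap σK σR σR hKR hKR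
  have hcl : (Submonoid.closure {e | τ e = e} : Set (R ⊗[K] R)) = {e | τ e = e} :=
    congrArg (SetLike.coe (A := Submonoid (R ⊗[K] R)))
      (Submonoid.closure_eq ((τ.eqLocus (RingHom.id _)).toSubmonoid))
  rw [constantSpan, ← Subalgebra.mem_toSubmodule, Algebra.adjoin_eq_span, hcl] at hx
  induction hx using Submodule.closure_induction with
  | zero => exact ⟨0, by simp, by simp⟩
  | add x y _ _ hx hy =>
    obtain ⟨g, hg, rfl⟩ := hx
    obtain ⟨g', hg', rfl⟩ := hy
    refine ⟨g + g', fun j => by simp [hg, hg'], ?_⟩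
    rw [Finsupp.sum_add_index'] <;> simp
  | smul_mem r e he =>
    refine ⟨(b.repr r).mapRange (fun c => algebraMap C R c • e) (by simp), fun j => ?_, ?_⟩
    · have he' : τ e = e := he
      simp only [Finsupp.mapRange_apply, Algebra.smul_def, map_mul, he']
      congr 1
      simp [τ, hC, Algebra.TensorProduct.algebraMap_apply]
    · rw [Finsupp.sum_mapRange_index (by simp)]
      conv_lhs => rw [← b.linearCombination_repr r, Finsupp.linearCombination_apply]
      rw [Finsupp.sum, Finset.sum_smul, Finsupp.sum]
      refine Finset.sum_congr rfl fun j _ => ?_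
      rw [Algebra.smul_def (_ : C), mul_comm, mul_smul]

/-- If every `1 ⊗ f` is an `R`-combination of constants of `R ⊗[K] R`, and all constants of the
overfield `L` lie in `R`, then `R` has no nontrivial ideals stable under `σR`. -/
theorem eq_bot_or_eq_top (σK : K →+* K) (σR : R →+* R) (σL : L →+* L)
    (hKR : ∀ c, σR (algebraMap K R c) = algebraMap K R (σK c))
    (hRL : ∀ r, σL (algebraMap R L r) = algebraMap R L (σR r))
    (hinj : Function.Injective (algebraMap R L))
    (hC : ∀ c, σR (algebraMap C R c) = algebraMap C R c)
    (hC' : ∀ x : L, σL x = x → ∃ c : C, algebraMap C L c = x)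
    (hspan : ∀ f : R, (1 : R) ⊗ₜ[K] f ∈ constantSpan σK σR hKR)
    (I : Ideal R) (hI : I ≤ I.comap σR) : I = ⊥ ∨ I = ⊤ := by
  classical
  rw [or_iff_not_imp_right]
  intro htop
  rw [eq_bot_iff]
  intro f hf
  let b := Module.Basis.ofVectorSpace C R
  obtain ⟨g, hg, hfg⟩ := exists_basis_expansion b σK σR hKR hC (hspan f)
  let σQ : R ⧸ I →+* R ⧸ I := Ideal.quotientMap I σR hI
  have hKQ (c : K) : σQ (algebraMap K (R ⧸ I) c) = algebraMap K (R ⧸ I) (σK c) := by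
    change σQ (Ideal.Quotient.mk I (algebraMap K R c)) = Ideal.Quotient.mk I _
    rw [Ideal.quotientMap_mk, hKR]
  have hKL (c : K) : σL (algebraMap K L c) = algebraMap K L (σK c) := by
    rw [IsScalarTower.algebraMap_apply K R L, IsScalarTower.algebraMap_apply K R L, hRL, hKR]
  let τ : L ⊗[K] (R ⧸ I) →+* L ⊗[K] (R ⧸ I) := tensorMap σK σL σQ hKL hKQ
  let q : R ⊗[K] R →ₐ[K] R ⊗[K] (R ⧸ I) :=
    Algebra.TensorProduct.map (AlgHom.id K R) (Ideal.Quotient.mkₐ K I)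
  let ι : R ⊗[K] (R ⧸ I) →ₐ[K] L ⊗[K] (R ⧸ I) :=
    Algebra.TensorProduct.map (IsScalarTower.toAlgHom K R L) (AlgHom.id K _)
  have hι : Function.Injective ι :=
    Module.Flat.rTensor_preserves_injective_linearMap (M := R ⧸ I)
      (IsScalarTower.toAlgHom K R L).toLinearMap hinj
  have hτ (x : R ⊗[K] R) : τ (ι (q x)) = ι (q (tensorMap σK σR σR hKR hKR x)) := by
    induction x using TensorProduct.induction_on with
    | zero => simp
    | add x y hx hy => simp only [map_add, hx, hy]
    | tmul x y => simp [τ, ι, q, σQ, hRL]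
  have hsmul (r : R) (x : R ⊗[K] R) : ι (q (r • x)) = algebraMap R L r • ι (q x) := by
    induction x using TensorProduct.induction_on with
    | zero => simp
    | add x y hx hy => simp only [map_add, smul_add, hx, hy]
    | tmul x y => simp [ι, q, TensorProduct.smul_tmul', Algebra.smul_def]
  have hzero : ∀ j ∈ g.support, ι (q (g j)) = 0 := by
    refine eq_zero_of_sum_smul_eq_zero σL τ.toAddMonoidHom (fun a v => ?_) _ (fun j => ?_) _
      (fun j => algebraMap R L (b j)) (fun c hc hsum => ?_) ?_
    · induction v using TensorProduct.induction_on with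
      | zero => simp
      | add x y hx hy => simp only [map_add, smul_add, hx, hy]
      | tmul x y => simp [τ, TensorProduct.smul_tmul']
    · simpa [hg] using hτ (g j)
    · choose d hd using fun i => hC' (c i) (hc i)
      have hli : LinearIndependent C b := b.linearIndependent
      rw [linearIndependent_iff'] at hli
      have := hli g.support d (hinj (by
        rw [map_sum, map_zero, ← hsum]
        refine Finset.sum_congr rfl fun i _ => ?_
        rw [Algebra.smul_def, map_mul, ← IsScalarTower.algebraMap_apply C R L, hd]))
      intro i hi
      rw [← hd, this i hi, map_zero]
    · have h0 : ι (q ((1 : R) ⊗ₜ[K] f)) = 0 := by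
        simp [ι, q, Ideal.Quotient.eq_zero_iff_mem.2 hf]
      rw [hfg, Finsupp.sum, map_sum, map_sum] at h0
      simpa only [hsmul] using h0
  let μ : R ⊗[K] R →ₐ[R] R := Algebra.TensorProduct.lift (AlgHom.id R R) (AlgHom.id K R)
    (fun _ _ => Commute.all _ _)
  let μQ : R ⊗[K] (R ⧸ I) →ₐ[K] R ⧸ I :=
    Algebra.TensorProduct.lift (Ideal.Quotient.mkₐ K I) (AlgHom.id K _)
      (fun _ _ => Commute.all _ _)
  have hμQ (x : R ⊗[K] R) : μQ (q x) = Ideal.Quotient.mk I (μ x) := by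
    induction x using TensorProduct.induction_on with
    | zero => simp
    | add x y hx hy => simp only [map_add, hx, hy]
    | tmul x y => simp [μQ, μ, q]
  have hμσ (x : R ⊗[K] R) : μ (tensorMap σK σR σR hKR hKR x) = σR (μ x) := by
    induction x using TensorProduct.induction_on with
    | zero => simp
    | add x y hx hy => simp only [map_add, hx, hy]
    | tmul x y => simp [μ]
  have hμ0 : ∀ j ∈ g.support, μ (g j) = 0 := by
    intro j hj
    have hmem : μ (g j) ∈ I := by
      rw [← Ideal.Quotient.eq_zero_iff_mem, ← hμQ, hι ((hzero j hj).trans (map_zero ι).symm),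
        map_zero]
    obtain ⟨c, hc⟩ := hC' (algebraMap R L (μ (g j))) (by rw [hRL, ← hμσ, hg])
    rw [IsScalarTower.algebraMap_apply C R L] at hc
    have hc := hinj hc
    by_contra hne
    refine htop (Ideal.eq_top_of_isUnit_mem I hmem (hc ▸ (IsUnit.mk0 c ?_).map (algebraMap C R)))
    rintro rfl
    exact hne (by rw [← hc, map_zero])
  have hfμ : f = μ ((1 : R) ⊗ₜ[K] f) := by simp [μ]
  rw [Ideal.mem_bot, hfμ, hfg, Finsupp.sum, map_sum]
  exact Finset.sum_eq_zero fun j hj => by rw [map_smul, hμ0 j hj, smul_zero]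

end Simple

section Prolongation

variable {K R : Type*} [CommRing K] [CommRing R] [Algebra K R]

/-- The ring homomorphism `x ↦ i x + ε • i (d x)` into the dual numbers attached to a derivation. -/
def derivationHom {T : Type*} [CommRing T] (i : R →+* T) (d : Derivation ℤ R R) :
    R →+* TrivSqZeroExt T T where
  toFun x := .inl (i x) + .inr (i (d x))
  map_one' := TrivSqZeroExt.ext (by simp) (by simp)
  map_mul' x y := TrivSqZeroExt.ext (by simp) (by simp [mul_comm (i y)])
  map_zero' := TrivSqZeroExt.ext (by simp) (by simp)
  map_add' x y := TrivSqZeroExt.ext (by simp) (by simp)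

theorem one_tmul_derivation_mem (σK : K →+* K) (σR : R →+* R)
    (hKR : ∀ c, σR (algebraMap K R c) = algebraMap K R (σK c)) (dK : K → K)
    (d : Derivation ℤ R R) (hd : ∀ c, d (algebraMap K R c) = algebraMap K R (dK c))
    (hσd : ∀ x, σR (d x) = d (σR x)) {f : R}
    (hf : (1 : R) ⊗ₜ[K] f ∈ constantSpan σK σR hKR) :
    (1 : R) ⊗ₜ[K] d f ∈ constantSpan σK σR hKR := by
  let φ : R ⊗[K] R →+* TrivSqZeroExt (R ⊗[K] R) (R ⊗[K] R) :=
    tensorLift (derivationHom Algebra.TensorProduct.includeLeftRingHom d)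
      (derivationHom Algebra.TensorProduct.includeRight.toRingHom d) (fun c => by
        refine TrivSqZeroExt.ext ?_ ?_
        · exact Algebra.TensorProduct.tmul_one_eq_one_tmul c
        · change d (algebraMap K R c) ⊗ₜ[K] (1 : R) = (1 : R) ⊗ₜ[K] d (algebraMap K R c)
          rw [hd]
          exact Algebra.TensorProduct.tmul_one_eq_one_tmul (dK c))
  have hfst (x : R ⊗[K] R) : (φ x).fst = x := by
    induction x using TensorProduct.induction_on with
    | zero => simp
    | add x y hx hy => simp only [map_add, TrivSqZeroExt.fst_add, hx, hy]
    | tmul x y => simp [φ, derivationHom]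
  have hsnd (x y : R) : (φ (x ⊗ₜ[K] y)).snd = x ⊗ₜ[K] d y + d x ⊗ₜ[K] y := by
    simp [φ, derivationHom]
  have hτ (x : R ⊗[K] R) : (φ (tensorMap σK σR σR hKR hKR x)).snd =
      tensorMap σK σR σR hKR hKR (φ x).snd := by
    induction x using TensorProduct.induction_on with
    | zero => simp
    | add x y hx hy => simp only [map_add, TrivSqZeroExt.snd_add, hx, hy]
    | tmul x y => simp only [tensorMap_tmul, hsnd, map_add, hσd]
  suffices h : ∀ x ∈ constantSpan σK σR hKR, (φ x).snd ∈ constantSpan σK σR hKR by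
    simpa [hsnd] using h _ hf
  intro x hx
  induction hx using Algebra.adjoin_induction with
  | mem x hx =>
    refine Algebra.subset_adjoin ?_
    have hx : tensorMap σK σR σR hKR hKR x = x := hx
    change tensorMap σK σR σR hKR hKR _ = _
    rw [← hτ, hx]
  | algebraMap r =>
    have : (φ (r ⊗ₜ[K] (1 : R))).snd = d r ⊗ₜ[K] (1 : R) := by simp [hsnd]
    change (φ (r ⊗ₜ[K] (1 : R))).snd ∈ _
    rw [this]
    exact Subalgebra.algebraMap_mem _ (d r)
  | add x y _ _ hx hy =>
    rw [map_add, TrivSqZeroExt.snd_add]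
    exact add_mem hx hy
  | mul x y hx' hy' hx hy =>
    rw [map_mul, TrivSqZeroExt.snd_mul, hfst, hfst, op_smul_eq_smul, smul_eq_mul, smul_eq_mul]
    exact add_mem (mul_mem hx' hy) (mul_mem hy' hx)

theorem one_tmul_mem_of_fundamental_matrix {n : Type*} [Fintype n] [DecidableEq n]
    (σK : K →+* K) (σR : R →+* R) (hKR : ∀ c, σR (algebraMap K R c) = algebraMap K R (σK c))
    (A : Matrix n n K) (X U : Matrix n n R) (hUX : U * X = 1)
    (hX : X.map σR = A.map (algebraMap K R) * X) :
    (∀ i j, (1 : R) ⊗ₜ[K] X i j ∈ constantSpan σK σR hKR) ∧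
      (1 : R) ⊗ₜ[K] U.det ∈ constantSpan σK σR hKR := by
  have hXU : X * U = 1 := mul_eq_one_comm.1 hUX
  let l : R →+* R ⊗[K] R := Algebra.TensorProduct.includeLeftRingHom
  let r : R →+* R ⊗[K] R := Algebra.TensorProduct.includeRight.toRingHom
  set τ : R ⊗[K] R →+* R ⊗[K] R := tensorMap σK σR σR hKR hKR with hτ
  have hτl (M : Matrix n n R) : (M.map l).map τ = (M.map σR).map l := by
    ext i j; simp [l, τ]
  have hτr (M : Matrix n n R) : (M.map r).map τ = (M.map σR).map r := by
    ext i j; simp [r, τ]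
  have hlr : (A.map (algebraMap K R)).map l = (A.map (algebraMap K R)).map r := by
    ext i j; exact Algebra.TensorProduct.tmul_one_eq_one_tmul _
  have hU : U.map σR * A.map (algebraMap K R) = U := by
    have h : (U * X).map σR = 1 := by rw [hUX]; exact σR.mapMatrix.map_one
    rw [Matrix.map_mul, hX, ← mul_assoc] at h
    rw [← mul_one (U.map σR * _), ← hXU, ← mul_assoc, h, one_mul]
  have hZ : (U.map l * X.map r).map τ = U.map l * X.map r := by
    rw [Matrix.map_mul, hτl, hτr, hX, Matrix.map_mul, ← hlr, ← mul_assoc, ← Matrix.map_mul, hU]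
  have hZ' : (U.map r * X.map l).map τ = U.map r * X.map l := by
    rw [Matrix.map_mul, hτl, hτr, hX, Matrix.map_mul, hlr, ← mul_assoc, ← Matrix.map_mul, hU]
  have hl (x : R) : l x ∈ constantSpan σK σR hKR := Subalgebra.algebraMap_mem _ x
  constructor
  · intro i j
    have h : X.map r = X.map l * (U.map l * X.map r) := by
      rw [← mul_assoc, ← Matrix.map_mul, hXU, Matrix.map_one _ l.map_zero l.map_one, one_mul]
    change X.map r i j ∈ _
    rw [h, Matrix.mul_apply]
    exact sum_mem fun k _ => mul_mem (hl _)
      (Algebra.subset_adjoin (congrFun (congrFun hZ k) j))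
  · have h : U.map r = (U.map r * X.map l) * U.map l := by
      rw [mul_assoc, ← Matrix.map_mul, hXU, Matrix.map_one _ l.map_zero l.map_one, mul_one]
    have hdet : r U.det = (U.map r * X.map l).det * l U.det := by
      rw [RingHom.map_det, RingHom.map_det, ← Matrix.det_mul]
      exact congrArg Matrix.det h
    change r U.det ∈ _
    rw [hdet]
    refine mul_mem (Algebra.subset_adjoin ?_) (hl _)
    change τ _ = _
    rw [RingHom.map_det]
    exact congrArg Matrix.det hZ'

end Prolongation

section Subring

variable {L : Type*} [Field L]

/-- A `σδ`-subring of a field that contains all constants of the field and is generated, as a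
`δ`-ring over a `σδ`-field, by an invertible solution matrix of a linear difference equation and
its inverse determinant is `σ`-simple. -/
theorem subring_eq_bot_or_eq_top (σ : L →+* L) (δ : Derivation ℤ L L)
    (hcomm : ∀ x, σ (δ x) = δ (σ x)) (K : Subfield L) (R : Subring L) (hKR : ∀ x ∈ K, x ∈ R)
    (hKσ : ∀ x ∈ K, σ x ∈ K) (hKδ : ∀ x ∈ K, δ x ∈ K) (hK : ∀ x, σ x = x → x ∈ K)
    (hRσ : ∀ x ∈ R, σ x ∈ R) (hRδ : ∀ x ∈ R, δ x ∈ R)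
    {n : Type*} [Fintype n] [DecidableEq n] (A X : Matrix n n L) (hA : ∀ i j, A i j ∈ K)
    (hX : ∀ i j, X i j ∈ R) (hdetR : X.det⁻¹ ∈ R) (hdet : X.det ≠ 0) (hσX : X.map σ = A * X)
    (hgen : ∀ S : Subring L, (∀ x ∈ K, x ∈ S) → (∀ i j, X i j ∈ S) → X.det⁻¹ ∈ S →
      (∀ x ∈ S, δ x ∈ S) → R ≤ S)
    (I : Ideal R) (hI : ∀ x ∈ I, (⟨σ x, hRσ x x.2⟩ : R) ∈ I) : I = ⊥ ∨ I = ⊤ := by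
  let C : Subfield L := σ.eqLocusField (RingHom.id L)
  let _ : Algebra K R := (K.subtype.codRestrict R fun x => hKR x x.2).toAlgebra
  let _ : Algebra C R := (C.subtype.codRestrict R fun x => hKR x (hK x x.2)).toAlgebra
  have : IsScalarTower K R L := .of_algebraMap_eq fun _ => rfl
  have : IsScalarTower C R L := .of_algebraMap_eq fun _ => rfl
  let σK : K →+* K := (σ.comp K.subtype).codRestrict K fun x => hKσ x x.2
  let σR : R →+* R := (σ.comp R.subtype).codRestrict R fun x => hRσ x x.2
  let d : Derivation ℤ R R :=
    Derivation.mk' (AddMonoidHom.toIntLinearMap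
      { toFun := fun x => ⟨δ x, hRδ x x.2⟩
        map_zero' := Subtype.ext (map_zero δ)
        map_add' := fun x y => Subtype.ext (map_add δ _ _) })
      fun x y => Subtype.ext (δ.leibniz x y)
  have hσKR (c : K) : σR (algebraMap K R c) = algebraMap K R (σK c) := rfl
  refine eq_bot_or_eq_top (C := C) (L := L) σK σR σ hσKR (fun _ => rfl) Subtype.val_injective
    (fun c => Subtype.ext c.2) (fun x hx => ⟨⟨x, hx⟩, rfl⟩) ?_ I hI
  let S : Subring R := (constantSpan σK σR hσKR).toSubring.comap
    (Algebra.TensorProduct.includeRight : R →ₐ[K] R ⊗[K] R).toRingHom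
  let X' : Matrix n n R := .of fun i j => ⟨X i j, hX i j⟩
  have hX'det : (X'.det : L) = X.det := R.subtype.map_det X'
  have hu : (⟨X.det⁻¹, hdetR⟩ : R) * X'.det = 1 :=
    Subtype.ext (by simpa [hX'det] using inv_mul_cancel₀ hdet)
  have hUX : ((⟨X.det⁻¹, hdetR⟩ : R) • X'.adjugate) * X' = 1 := by
    rw [Matrix.smul_mul, Matrix.adjugate_mul, smul_smul, hu, one_smul]
  have hUdet : ((⟨X.det⁻¹, hdetR⟩ : R) • X'.adjugate).det = ⟨X.det⁻¹, hdetR⟩ := by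
    have h := congrArg Matrix.det hUX
    rw [Matrix.det_mul, Matrix.det_one] at h
    exact left_inv_eq_right_inv h ((mul_comm _ _).trans hu)
  obtain ⟨h₁, h₂⟩ := one_tmul_mem_of_fundamental_matrix σK σR hσKR
    (.of fun i j => ⟨A i j, hA i j⟩) X' _ hUX (by
      ext i j
      have := congrFun (congrFun hσX i) j
      simp only [Matrix.mul_apply] at this ⊢
      rw [AddSubmonoidClass.coe_finsetSum]
      exact this)
  rw [hUdet] at h₂
  have hle : R ≤ S.map R.subtype := by
    refine hgen _ (fun x hx => ⟨⟨x, hKR x hx⟩, ?_, rfl⟩) (fun i j => ⟨_, h₁ i j, rfl⟩)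
      ⟨_, h₂, rfl⟩ ?_
    · change (1 : R) ⊗ₜ[K] algebraMap K R ⟨x, hx⟩ ∈ constantSpan σK σR hσKR
      rw [← Algebra.TensorProduct.tmul_one_eq_one_tmul]
      exact Subalgebra.algebraMap_mem _ (algebraMap K R ⟨x, hx⟩)
    · rintro _ ⟨x, hx, rfl⟩
      exact ⟨d x, one_tmul_derivation_mem σK σR hσKR (fun c => ⟨δ c, hKδ c c.2⟩) d
        (fun _ => rfl) (fun x => Subtype.ext (hcomm x)) hx, rfl⟩
  intro f
  obtain ⟨g, hg, hgf⟩ := hle f.2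
  rwa [← Subtype.ext hgf]

theorem derivation_mem_subfieldClosure (δ : Derivation ℤ L L) {s : Set L}
    (hs : ∀ x ∈ s, δ x ∈ Subfield.closure s) {x : L} (hx : x ∈ Subfield.closure s) :
    δ x ∈ Subfield.closure s := by
  induction hx using Subfield.closure_induction with
  | mem x hx => exact hs x hx
  | one => simp
  | add x y _ _ hx hy => rw [map_add]; exact add_mem hx hy
  | neg x _ hx => rw [map_neg]; exact neg_mem hx
  | inv x hx' hx =>
    rw [δ.leibniz_inv, smul_eq_mul]
    exact mul_mem (neg_mem (pow_mem (inv_mem hx') 2)) hx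
  | mul x y hx' hy' hx hy =>
    rw [δ.leibniz, smul_eq_mul, smul_eq_mul]
    exact add_mem (mul_mem hx' hy) (mul_mem hy' hx)

theorem derivation_mem_subringClosure (δ : Derivation ℤ L L) {s : Set L}
    (hs : ∀ x ∈ s, δ x ∈ Subring.closure s) {x : L} (hx : x ∈ Subring.closure s) :
    δ x ∈ Subring.closure s := by
  induction hx using Subring.closure_induction with
  | mem x hx => exact hs x hx
  | zero => simp
  | one => simp
  | add x y _ _ hx hy => rw [map_add]; exact add_mem hx hy
  | neg x _ hx => rw [map_neg]; exact neg_mem hx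
  | mul x y hx' hy' hx hy =>
    rw [δ.leibniz, smul_eq_mul, smul_eq_mul]
    exact add_mem (mul_mem hx' hy) (mul_mem hy' hx)

end Subring

theorem iterate_map_apply {L n : Type*} (f : L → L) (X : Matrix n n L) (t : ℕ) (i j : n) :
    ((fun M : Matrix n n L => M.map f)^[t] X) i j = f^[t] (X i j) := by
  induction t generalizing X with
  | zero => rfl
  | succ t ih => rw [Function.iterate_succ_apply, ih]; rfl

theorem iterate_mem {L : Type*} {S : Set L} {f : L → L} (hf : ∀ x ∈ S, f x ∈ S) {x : L} (hx : x ∈ S) (t : ℕ) :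
    f^[t] x ∈ S :=
  (Set.MapsTo.iterate hf t) hx

end DifferenceRing

/-- Let `k` be a `σδ`-field of characteristic 0 with `σδ = δσ` whose field of
`σ`-constants `C_k` is relatively algebraically closed in `k` (`D_k = C_k`).  Let
`L = k⟨X, det(X)⁻¹⟩` with `σ(X) = AX`, `A ∈ GL_m(k)`.  Then the differential ring
`R = kC_L{X, det(X)⁻¹}` is a simple `σ`-ring. -/
theorem stmt9 {L : Type*} [Field L] [CharZero L]
    (σ : L ≃+* L) (δ : Derivation ℤ L L)
    (hcomm : ∀ x : L, σ (δ x) = δ (σ x))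
    (k : Subfield L)
    (hkσ : ∀ x ∈ k, σ x ∈ k) (hkσ' : ∀ x ∈ k, σ.symm x ∈ k)
    (hkδ : ∀ x ∈ k, δ x ∈ k)
    -- `D_k = C_k` : every element of `k` algebraic over `C_k` is a `σ`-constant
    (hDk : ∀ x ∈ k, (∃ p : Polynomial L, p.Monic ∧
      (∀ i, p.coeff i ∈ k ∧ σ (p.coeff i) = p.coeff i) ∧ p.eval x = 0) → σ x = x)
    {m : ℕ} (A : Matrix (Fin m) (Fin m) L) (hAk : ∀ i j, A i j ∈ k) (hA : IsUnit A.det)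
    (X : Matrix (Fin m) (Fin m) L) (hX : IsUnit X.det)
    (hσX : X.map σ = A * X)
    -- `L = k⟨X, det(X)⁻¹⟩`: `L` is generated over `k`, as a `δ`-field, by the entries of `X`
    (hLgen : ∀ F : Subfield L, k ≤ F → (∀ i j, X i j ∈ F) →
      (∀ y ∈ F, δ y ∈ F) → F = ⊤) :
    -- `kC_L`: compositum of `k` and the `σ`-constants of `L`
    letI kCL : Subfield L := Subfield.closure ((k : Set L) ∪ {x | σ x = x})
    -- `R = kC_L{X, det(X)⁻¹}`: the `δ`-subring generated over `kC_L` by `X` and `det(X)⁻¹`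
    letI R : Subring L := Subring.closure ((kCL : Set L) ∪
      {y | ∃ (n : ℕ) (i j : Fin m),
        y = ((fun M : Matrix (Fin m) (Fin m) L => M.map δ)^[n] X) i j} ∪
      {y | ∃ n : ℕ, y = (⇑δ)^[n] (X.det⁻¹)})
    ∀ I : Ideal R, (∀ x : R, x ∈ I → ∀ h : σ (x : L) ∈ R, (⟨σ (x : L), h⟩ : R) ∈ I) →
      I = ⊥ ∨ I = ⊤ := by
  set kCL : Subfield L := Subfield.closure ((k : Set L) ∪ {x | σ x = x})
  set R : Subring L := Subring.closure ((kCL : Set L) ∪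
    {y | ∃ (n : ℕ) (i j : Fin m),
      y = ((fun M : Matrix (Fin m) (Fin m) L => M.map δ)^[n] X) i j} ∪
    {y | ∃ n : ℕ, y = (⇑δ)^[n] (X.det⁻¹)})
  intro I hI
  have hkK : ∀ x ∈ k, x ∈ kCL := fun x hx => Subfield.subset_closure (Or.inl hx)
  have hCK : ∀ x, σ x = x → x ∈ kCL := fun x hx => Subfield.subset_closure (Or.inr hx)
  have hKσ : ∀ x ∈ kCL, σ x ∈ kCL := by
    have h : kCL ≤ kCL.comap (σ : L →+* L) := Subfield.closure_le.2 <| by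
      rintro x (hx | hx)
      · exact hkK _ (hkσ x hx)
      · exact hCK _ (congrArg σ hx)
    exact h
  have hKδ : ∀ x ∈ kCL, δ x ∈ kCL := fun x hx =>
    DifferenceRing.derivation_mem_subfieldClosure δ (fun y hy => by
      rcases hy with hy | hy
      · exact hkK _ (hkδ y hy)
      · exact hCK _ ((hcomm y).trans (congrArg δ hy))) hx
  have hKR : ∀ x ∈ kCL, x ∈ R := fun x hx => Subring.subset_closure (Or.inl (Or.inl hx))
  have hXn (t : ℕ) (i j : Fin m) : δ^[t] (X i j) ∈ R :=
    Subring.subset_closure (Or.inl (Or.inr ⟨t, i, j, by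
      rw [DifferenceRing.iterate_map_apply]⟩))
  have hdn (t : ℕ) : δ^[t] X.det⁻¹ ∈ R := Subring.subset_closure (Or.inr ⟨t, rfl⟩)
  have hRδ : ∀ x ∈ R, δ x ∈ R := fun x hx =>
    DifferenceRing.derivation_mem_subringClosure δ (fun y hy => by
      rcases hy with (hy | ⟨t, i, j, rfl⟩) | ⟨t, rfl⟩
      · exact hKR _ (hKδ y hy)
      · rw [DifferenceRing.iterate_map_apply, ← Function.iterate_succ_apply' (⇑δ)]
        exact hXn (t + 1) i j
      · rw [← Function.iterate_succ_apply' (⇑δ)]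
        exact hdn (t + 1)) hx
  have hσδ (t : ℕ) (x : L) : σ (δ^[t] x) = δ^[t] (σ x) :=
    Function.Semiconj.iterate_right hcomm t x
  have hRσ : ∀ x ∈ R, σ x ∈ R := by
    have h : R ≤ R.comap (σ : L →+* L) := Subring.closure_le.2 <| by
      rintro y ((hy | ⟨t, i, j, rfl⟩) | ⟨t, rfl⟩)
      · exact hKR _ (hKσ y hy)
      · change σ _ ∈ R
        rw [DifferenceRing.iterate_map_apply, hσδ]
        refine DifferenceRing.iterate_mem (S := (R : Set L)) hRδ ?_ t
        have h : σ (X i j) = (A * X) i j := congrFun (congrFun hσX i) j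
        rw [h, Matrix.mul_apply]
        exact sum_mem fun l _ => mul_mem (hKR _ (hkK _ (hAk i l))) (hXn 0 l j)
      · change σ _ ∈ R
        rw [hσδ]
        refine DifferenceRing.iterate_mem (S := (R : Set L)) hRδ ?_ t
        have h : σ X.det = A.det * X.det := by
          rw [← Matrix.det_mul, ← hσX]
          exact (σ : L →+* L).map_det X
        rw [map_inv₀, h, mul_inv]
        refine mul_mem (hKR _ (hkK _ (inv_mem ?_))) (hdn 0)
        rw [Matrix.det_apply]
        exact sum_mem fun p _ => Subfield.zsmul_mem _ (prod_mem fun l _ => hAk _ _) _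
    exact h
  refine DifferenceRing.subring_eq_bot_or_eq_top (σ : L →+* L) δ hcomm kCL R hKR hKσ hKδ hCK hRσ hRδ
    A X (fun i j => hkK _ (hAk i j)) (hXn 0) (hdn 0) hX.ne_zero hσX ?_ I
    (fun x hx => hI x hx _)
  intro S hKS hXS hdS hSδ
  refine Subring.closure_le.2 ?_
  rintro y ((hy | ⟨t, i, j, rfl⟩) | ⟨t, rfl⟩)
  · exact hKS y hy
  · rw [DifferenceRing.iterate_map_apply]
    exact DifferenceRing.iterate_mem (S := (S : Set L)) hSδ (hXS i j) t
  · exact DifferenceRing.iterate_mem (S := (S : Set L)) hSδ hdS t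
end

section
/- With k, L, R as in the construction of the Picard–Vessiot extension, the group G = Aut_{σδ}(kC_L⟨X⟩/kC_L) is isomorphic to the group H = {B ∈ GL_m(C_L) : the automorphism g_B : Y ↦ YB of kC_L{Y} leaves the differential vanishing ideal I_δ of X invariant}. -/
open Finset in
theorem Derivation.iterate_apply_mul {L : Type*} [CommRing L] (δ : Derivation ℤ L L) (n : ℕ)
    (x y : L) :
    δ^[n] (x * y) = ∑ j ∈ range (n + 1), n.choose j • (δ^[j] x * δ^[n - j] y) := by
  induction n with
  | zero => simp
  | succ n ih =>
    rw [Function.iterate_succ_apply', ih, map_sum,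
      sum_choose_succ_nsmul (fun i j => δ^[i] x * δ^[j] y) n, ← sum_add_distrib]
    refine sum_congr rfl fun j hj => ?_
    rw [map_nsmul, Derivation.leibniz, Nat.succ_sub (mem_range_succ_iff.mp hj), ← nsmul_add,
      Function.iterate_succ_apply', Function.iterate_succ_apply']
    simp only [smul_eq_mul]
    ring

theorem Derivation.iterate_map_sum {L ι : Type*} [CommRing L] (δ : Derivation ℤ L L) (n : ℕ)
    (s : Finset ι) (f : ι → L) : δ^[n] (∑ i ∈ s, f i) = ∑ i ∈ s, δ^[n] (f i) := by
  induction n with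
  | zero => rfl
  | succ n ih => simp only [Function.iterate_succ_apply', ih, map_sum]

theorem Matrix.iterate_map_apply {L m : Type*} (f : L → L) (X : Matrix m m L) (n : ℕ) (a b : m) :
    ((fun M : Matrix m m L => M.map f)^[n] X) a b = f^[n] (X a b) := by
  induction n with
  | zero => rfl
  | succ n ih => rw [Function.iterate_succ_apply', Function.iterate_succ_apply', ← ih, map_apply]

theorem RingHom.injective_of_surjective_of_isNoetherianRing {R : Type*} [CommRing R]
    [IsNoetherianRing R] (f : R →+* R) (hf : Function.Surjective f) : Function.Injective f := by
  have hker : ∀ (n : ℕ) (x : R), x ∈ RingHom.ker (f ^ n) ↔ f^[n] x = 0 := fun n x => by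
    rw [RingHom.mem_ker, RingHom.coe_pow]
  obtain ⟨n, hn⟩ := monotone_stabilizes_iff_noetherian.mpr ‹IsNoetherianRing R›
    ⟨fun n => RingHom.ker (f ^ n), monotone_nat_of_le_succ fun n x hx => by
      rw [hker] at hx ⊢
      rw [Function.iterate_succ_apply', hx, map_zero]⟩
  refine (injective_iff_map_eq_zero f).mpr fun x hx => ?_
  obtain ⟨y, rfl⟩ := hf.iterate n x
  have hy : y ∈ RingHom.ker (f ^ (n + 1)) := by
    rw [hker, Function.iterate_succ_apply', hx]
  rw [← hker]
  exact (hn (n + 1) n.le_succ).ge hy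

/-- An algebra endomorphism which maps each member of an exhaustive chain of finitely generated
subalgebras onto itself is injective. -/
theorem AlgHom.injective_of_map_eq_of_fg {K R : Type*} [Field K] [CommRing R] [Algebra K R]
    (f : R →ₐ[K] R) (T : ℕ → Subalgebra K R) (hfg : ∀ n, (T n).FG)
    (hmap : ∀ n, (T n).map f = T n) (hex : ∀ x, ∃ n, x ∈ T n) : Function.Injective f := by
  refine (injective_iff_map_eq_zero f).mpr fun x hx => ?_
  obtain ⟨n, hn⟩ := hex x
  have : IsNoetherianRing (T n) := isNoetherianRing_of_fg (hfg n)
  let g : T n →ₐ[K] T n := (f.comp (T n).val).codRestrict (T n) fun y =>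
    (hmap n).le ⟨y, y.2, rfl⟩
  have hg : Function.Surjective g := fun y => by
    obtain ⟨z, hz, hzy⟩ := (hmap n).ge y.2
    exact ⟨⟨z, hz⟩, Subtype.ext hzy⟩
  have := RingHom.injective_of_surjective_of_isNoetherianRing (g : T n →+* T n) hg
    (a₁ := ⟨x, hn⟩) (a₂ := 0) (by simpa [g, Subtype.ext_iff] using hx)
  simpa using congrArg Subtype.val this

/-- An endomorphism of an algebra generated by the entries of matrices `Y₀, Y₁, …` which acts by
`Yₙ ↦ ∑ⱼ (n choose j) Yₙ₋ⱼ Dⱼ` with `D₀` invertible is injective. -/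
theorem AlgHom.injective_of_apply_eq_sum_choose {K R m : Type*} [Field K] [CommRing R]
    [Algebra K R] [Fintype m] [DecidableEq m] (f : R →ₐ[K] R) (x : ℕ × m × m → R)
    (D : ℕ → Matrix m m K) (hD : IsUnit (D 0).det)
    (hx : Algebra.adjoin K (Set.range x) = ⊤)
    (hf : ∀ n a b, f (x (n, a, b)) = ∑ j ∈ Finset.range (n + 1), n.choose j •
      ∑ c, algebraMap K R (D j c b) * x (n - j, a, c)) : Function.Injective f := by
  have hmono : Monotone fun n => Algebra.adjoin K (x '' {v | v.1 ≤ n}) := fun i j hij =>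
    Algebra.adjoin_mono (Set.image_mono fun v hv => le_trans hv hij)
  refine f.injective_of_map_eq_of_fg (fun n => Algebra.adjoin K (x '' {v | v.1 ≤ n})) ?_ ?_ ?_
  · intro n
    refine Subalgebra.fg_def.mpr ⟨_, Set.Finite.image _ ?_, rfl⟩
    exact ((Set.finite_Iic n).prod Set.finite_univ).subset fun v hv => ⟨hv, trivial⟩
  · intro n
    have hmem : ∀ i a b, i ≤ n → x (i, a, b) ∈ Algebra.adjoin K (x '' {v | v.1 ≤ n}) :=
      fun i a b hi => Algebra.subset_adjoin ⟨_, hi, rfl⟩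
    refine le_antisymm ?_ (Algebra.adjoin_le ?_)
    · rw [AlgHom.map_adjoin, Algebra.adjoin_le_iff]
      rintro _ ⟨_, ⟨⟨i, a, b⟩, hi, rfl⟩, rfl⟩
      rw [hf]
      exact sum_mem fun j _ => nsmul_mem (sum_mem fun c _ => mul_mem (algebraMap_mem _ _)
        (hmem _ _ _ ((Nat.sub_le _ _).trans hi))) _
    · set T := (Algebra.adjoin K (x '' {v | v.1 ≤ n})).map f
      rintro _ ⟨⟨i, a, b⟩, hi, rfl⟩
      simp only [Set.mem_ofPred_eq] at hi
      induction i using Nat.strong_induction_on generalizing a b with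
      | _ i ih =>
      have hlead : ∀ d, ∑ c, algebraMap K R (D 0 c d) * x (i, a, c) ∈ T := fun d => by
        have h := hf i a d
        rw [Finset.sum_range_succ'] at h
        simp only [Nat.choose_zero_right, one_smul, Nat.sub_zero] at h
        rw [← sub_eq_iff_eq_add'] at h
        rw [← h]
        refine sub_mem ⟨_, hmem i a d hi, rfl⟩ (sum_mem fun j hj => nsmul_mem (sum_mem fun c _ =>
          mul_mem (algebraMap_mem _ _) (ih _ ?_ a c ?_)) _)
        · have := Finset.mem_range.mp hj; omega
        · omega
      have hinv : x (i, a, b) = ∑ d, algebraMap K R ((D 0)⁻¹ d b) *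
          ∑ c, algebraMap K R (D 0 c d) * x (i, a, c) := by
        have h1 : ∀ c, ∑ d, D 0 c d * (D 0)⁻¹ d b = (1 : Matrix m m K) c b := fun c => by
          rw [← Matrix.mul_nonsing_inv _ hD, Matrix.mul_apply]
        simp only [Finset.mul_sum, ← mul_assoc, ← map_mul]
        rw [Finset.sum_comm]
        simp only [mul_comm ((D 0)⁻¹ _ _), ← Finset.sum_mul, ← map_sum, h1]
        simp [Matrix.one_apply]
      rw [SetLike.mem_coe, hinv]
      exact sum_mem fun d _ => mul_mem (algebraMap_mem _ _) (hlead d)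
  · intro y
    have hy : y ∈ Algebra.adjoin K (Set.range x) := hx ▸ Algebra.mem_top
    induction hy using Algebra.adjoin_induction with
    | mem y hy =>
      obtain ⟨v, rfl⟩ := hy
      exact ⟨v.1, Algebra.subset_adjoin ⟨v, le_refl v.1, rfl⟩⟩
    | algebraMap r => exact ⟨0, algebraMap_mem _ r⟩
    | add y z _ _ hy hz =>
      obtain ⟨⟨i, hi⟩, j, hj⟩ := And.intro hy hz
      exact ⟨max i j, add_mem (hmono (le_max_left i j) hi) (hmono (le_max_right i j) hj)⟩
    | mul y z _ _ hy hz =>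
      obtain ⟨⟨i, hi⟩, j, hj⟩ := And.intro hy hz
      exact ⟨max i j, mul_mem (hmono (le_max_left i j) hi) (hmono (le_max_right i j) hj)⟩

open MvPolynomial in
/-- A substitution `Yₙ ↦ ∑ⱼ (n choose j) Yₙ₋ⱼ Dⱼ` with `D₀` invertible which preserves the vanishing
ideal of a family of field generators extends to an endomorphism of the field. -/
theorem exists_algHom_of_ker_le_comap {K L m : Type*} [Field K] [Field L] [Algebra K L]
    [Fintype m] [DecidableEq m] (x : ℕ × m × m → L)
    (hx : IntermediateField.adjoin K (Set.range x) = ⊤)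
    (D : ℕ → Matrix m m K) (hD : IsUnit (D 0).det)
    (G : MvPolynomial (ℕ × m × m) K →ₐ[K] MvPolynomial (ℕ × m × m) K)
    (hG : ∀ v, G (X v) = ∑ j ∈ Finset.range (v.1 + 1), v.1.choose j •
      ∑ c, C (D j c v.2.2) * X (v.1 - j, v.2.1, c))
    (hker : ∀ p, aeval x p = 0 → aeval x (G p) = 0) :
    ∃ g : L →ₐ[K] L, ∀ p, g (aeval x p) = aeval x (G p) := by
  let e : MvPolynomial (ℕ × m × m) K →ₐ[K] L := aeval x
  let f : e.range →ₐ[K] e.range := AlgHom.liftOfSurjective e.rangeRestrict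
    e.rangeRestrict_surjective (e.rangeRestrict.comp G) fun p hp =>
      Subtype.ext (hker p (congrArg Subtype.val hp))
  have hf : ∀ p, f (e.rangeRestrict p) = e.rangeRestrict (G p) := fun p =>
    AlgHom.liftOfSurjective_apply _ _ _ _ p
  have hinj : Function.Injective f := by
    refine f.injective_of_apply_eq_sum_choose (fun v => e.rangeRestrict (X v)) D hD ?_ ?_
    · have : Set.range (fun v => e.rangeRestrict (X v)) = e.rangeRestrict '' Set.range X := by
        rw [← Set.range_comp]; rfl
      rw [this, ← AlgHom.map_adjoin, adjoin_range_X, Algebra.map_top]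
      exact AlgHom.range_eq_top _ |>.mpr e.rangeRestrict_surjective
    · intro n a b
      rw [hf, hG]
      simp only [map_sum, map_nsmul, map_mul, ← algebraMap_eq, AlgHom.commutes]
  have hfrac : IsFractionRing e.range L := by
    refine IsFractionRing.of_field _ _ fun z => ?_
    have hz : z ∈ IntermediateField.adjoin K (Set.range x) := hx ▸ trivial
    obtain ⟨r, hr, s, hs, rfl⟩ := IntermediateField.mem_adjoin_iff_div.mp hz
    rw [Algebra.adjoin_range_eq_range_aeval] at hr hs
    exact ⟨⟨r, hr⟩, ⟨s, hs⟩, rfl⟩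
  have hinj' : Function.Injective (e.range.val.comp f) := Subtype.val_injective.comp hinj
  refine ⟨IsFractionRing.liftAlgHom hinj', fun p => ?_⟩
  have := IsFractionRing.lift_algebraMap (K := L) (g := (e.range.val.comp f).toRingHom) hinj'
    (e.rangeRestrict p)
  refine this.trans ?_
  exact congrArg Subtype.val (hf p)

/-- The subfield on which a ring endomorphism commutes with a derivation. -/
def Derivation.commSubfield {L : Type*} [Field L] (δ : Derivation ℤ L L) (g : L →+* L) :
    Subfield L where
  carrier := {x | g (δ x) = δ (g x)}
  one_mem' := by simp
  zero_mem' := by simp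
  add_mem' {x y} (hx : g (δ x) = δ (g x)) (hy : g (δ y) = δ (g y)) := by
    simp [hx, hy]
  neg_mem' {x} (hx : g (δ x) = δ (g x)) := by simp [hx]
  mul_mem' {x y} (hx : g (δ x) = δ (g x)) (hy : g (δ y) = δ (g y)) := by
    simp [hx, hy]
  inv_mem' x (hx : g (δ x) = δ (g x)) := by
    change g (δ x⁻¹) = δ (g x⁻¹)
    rw [map_inv₀ g, δ.leibniz_inv, δ.leibniz_inv, smul_eq_mul, smul_eq_mul, map_mul, map_neg, map_pow,
      map_inv₀, hx]

theorem Derivation.apply_mem_closure {L : Type*} [Field L] (δ : Derivation ℤ L L) (s : Set L)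
    (hs : ∀ x ∈ s, δ x ∈ Subfield.closure s) {x : L} (hx : x ∈ Subfield.closure s) :
    δ x ∈ Subfield.closure s := by
  induction hx using Subfield.closure_induction with
  | mem x hx => exact hs x hx
  | one => simp
  | add x y _ _ hx hy => rw [map_add]; exact add_mem hx hy
  | neg x _ hx => rw [map_neg]; exact neg_mem hx
  | inv x h hx =>
    rw [Derivation.leibniz_inv]
    exact mul_mem (neg_mem (pow_mem (inv_mem h) 2)) hx
  | mul x y h h' hx hy =>
    rw [Derivation.leibniz]
    exact add_mem (mul_mem h hy) (mul_mem h' hx)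


theorem Derivation.iterate_mul_matrix_apply {L m : Type*} [Field L] [Fintype m]
    (δ : Derivation ℤ L L) {K : Subfield L} (X : Matrix m m L) (D : ℕ → Matrix m m K)
    (hD : ∀ j a b, (D (j + 1) a b : L) = δ (D j a b)) (n : ℕ) (a b : m) :
    δ^[n] ((X * Matrix.of fun a b => (D 0 a b : L)) a b) =
      ∑ j ∈ Finset.range (n + 1), n.choose j • ∑ c, (D j c b : L) * δ^[n - j] (X a c) := by
  have hD' : ∀ j a b, (D j a b : L) = δ^[j] (D 0 a b) := fun j a b => by
    induction j with
    | zero => rfl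
    | succ j ih => rw [hD, ih, Function.iterate_succ_apply']
  simp only [Matrix.mul_apply, Matrix.of_apply, mul_comm (X _ _), δ.iterate_map_sum,
    δ.iterate_apply_mul, ← hD', Finset.smul_sum]
  exact Finset.sum_comm

theorem MvPolynomial.aeval_iterate_derivation_comp {L m : Type*} [Field L] [Fintype m]
    (δ : Derivation ℤ L L) {K : Subfield L} (X : Matrix m m L) (D : ℕ → Matrix m m K)
    (hD : ∀ j a b, (D (j + 1) a b : L) = δ (D j a b)) (p : MvPolynomial (ℕ × m × m) K) :
    aeval (fun v : ℕ × m × m => δ^[v.1] (X v.2.1 v.2.2))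
        (aeval (fun v : ℕ × m × m => ∑ j ∈ Finset.range (v.1 + 1), v.1.choose j •
          ∑ c, C (D j c v.2.2) * MvPolynomial.X (v.1 - j, v.2.1, c)) p) =
      aeval (fun v : ℕ × m × m =>
        δ^[v.1] ((X * Matrix.of fun a b => (D 0 a b : L)) v.2.1 v.2.2)) p := by
  rw [← AlgHom.comp_apply, comp_aeval]
  congr 2
  funext v
  simp only [map_sum, map_nsmul, map_mul, aeval_C, aeval_X, δ.iterate_mul_matrix_apply X D hD]
  rfl

/-- The fixed matrix `X⁻¹ g(X)` attached to a `σ`-automorphism `g`. -/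
theorem Matrix.map_inv_mul_map_eq {L m : Type*} [Field L] [Fintype m] [DecidableEq m]
    (σ g : L ≃+* L) (hg : ∀ x, g (σ x) = σ (g x)) (A X : Matrix m m L)
    (hA : IsUnit A.det) (hX : IsUnit X.det) (hσX : X.map σ = A * X) (hgA : A.map g = A) :
    (X⁻¹ * X.map g).map σ = X⁻¹ * X.map g := by
  have hX' : X * (X⁻¹ * X.map g) = X.map g := Matrix.mul_nonsing_inv_cancel_left _ _ hX
  have h1 : (X.map g).map σ = A * X.map g := by
    calc (X.map g).map σ = (X.map σ).map g := by ext i j; simp [hg]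
      _ = A * X.map g := by rw [hσX, Matrix.map_mul, hgA]
  have h2 : A * X * (X⁻¹ * X.map g).map σ = A * X * (X⁻¹ * X.map g) := by
    rw [← hσX, ← Matrix.map_mul, hX', h1, hσX, mul_assoc, hX']
  have hAX : IsUnit (A * X).det := by rw [Matrix.det_mul]; exact hA.mul hX
  simpa [Matrix.nonsing_inv_mul_cancel_left _ _ hAX] using congrArg ((A * X)⁻¹ * ·) h2

/-- Automorphisms commuting with a derivation which agree on differential field generators agree. -/
theorem RingEquiv.eq_of_eqOn_differential_generators {L m : Type*} [Field L]
    (δ : Derivation ℤ L L) (k : Subfield L) (X : Matrix m m L)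
    (hgen : ∀ F : Subfield L, k ≤ F → (∀ i j, X i j ∈ F) → (∀ y ∈ F, δ y ∈ F) → F = ⊤)
    (g h : L ≃+* L) (hg : ∀ x, g (δ x) = δ (g x)) (hh : ∀ x, h (δ x) = δ (h x))
    (hk : ∀ x ∈ k, g x = h x) (hX : X.map g = X.map h) : g = h := by
  have := hgen ((g : L →+* L).eqLocusField (h : L →+* L)) hk
    (fun i j => congrFun (congrFun hX i) j) (fun y hy => by
      change g (δ y) = h (δ y)
      rw [hg, hh]
      exact congrArg δ hy)
  ext x
  have hx : x ∈ (g : L →+* L).eqLocusField (h : L →+* L) := this ▸ trivial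
  exact hx

open MvPolynomial in
/-- An invertible matrix of `σ`-constants whose action preserves the differential vanishing ideal
of `X` comes from a `σδ`-automorphism. -/
theorem exists_ringEquiv_of_preserves_vanishing {L m : Type*} [Field L] [Fintype m] [DecidableEq m]
    (σ : L ≃+* L) (δ : Derivation ℤ L L) (hcomm : ∀ x, σ (δ x) = δ (σ x))
    (k K : Subfield L) (hkK : k ≤ K) (hKσ : ∀ x ∈ K, σ x ∈ K) (hKδ : ∀ x ∈ K, δ x ∈ K)
    (A X : Matrix m m L) (hAK : ∀ i j, A i j ∈ K) (hσX : X.map σ = A * X)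
    (hgen : ∀ F : Subfield L, k ≤ F → (∀ i j, X i j ∈ F) → (∀ y ∈ F, δ y ∈ F) → F = ⊤)
    (D : ℕ → Matrix m m K) (hD : ∀ j a b, (D (j + 1) a b : L) = δ (D j a b))
    (hσD : ∀ a b, σ (D 0 a b) = D 0 a b)
    (hdet : IsUnit (Matrix.of fun a b => (D 0 a b : L)).det)
    (hker : ∀ p : MvPolynomial (ℕ × m × m) K,
      aeval (fun v : ℕ × m × m => δ^[v.1] (X v.2.1 v.2.2)) p = 0 →
      aeval (fun v : ℕ × m × m => δ^[v.1] (X v.2.1 v.2.2))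
        (aeval (fun v : ℕ × m × m => ∑ j ∈ Finset.range (v.1 + 1), v.1.choose j •
          ∑ c, C (D j c v.2.2) * MvPolynomial.X (v.1 - j, v.2.1, c)) p :
            MvPolynomial (ℕ × m × m) K) = 0) :
    ∃ g : L ≃+* L, (∀ x, g (σ x) = σ (g x)) ∧ (∀ x, g (δ x) = δ (g x)) ∧ (∀ x ∈ K, g x = x) ∧
      X.map g = X * Matrix.of fun a b => (D 0 a b : L) := by
  set B : Matrix m m L := Matrix.of fun a b => (D 0 a b : L) with hB
  let x : ℕ × m × m → L := fun v => δ^[v.1] (X v.2.1 v.2.2)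
  have hsub : ∀ F : Subfield L, K ≤ F → (∀ v, x v ∈ F) → F = ⊤ := fun F hKF hxF => by
    have hcl : Subfield.closure ((K : Set L) ∪ Set.range x) = ⊤ := by
      refine hgen _ (fun y hy => Subfield.subset_closure (.inl (hkK hy)))
        (fun i j => Subfield.subset_closure (.inr ⟨(0, i, j), rfl⟩))
        fun y hy => δ.apply_mem_closure _ ?_ hy
      rintro z (hz | ⟨⟨n, a, b⟩, rfl⟩)
      · exact Subfield.subset_closure (.inl (hKδ z hz))
      · exact Subfield.subset_closure
          (.inr ⟨(n + 1, a, b), Function.iterate_succ_apply' _ _ _⟩)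
    refine top_le_iff.mp (hcl ▸ Subfield.closure_le.mpr (Set.union_subset hKF ?_))
    rintro _ ⟨v, rfl⟩
    exact hxF v
  have hadj : IntermediateField.adjoin K (Set.range x) = ⊤ := by
    have := hsub (IntermediateField.adjoin K (Set.range x)).toSubfield
      (fun y hy => (IntermediateField.adjoin K (Set.range x)).algebraMap_mem ⟨y, hy⟩)
      (fun v => IntermediateField.subset_adjoin _ _ ⟨v, rfl⟩)
    exact IntermediateField.toSubfield_injective this
  have hD0 : IsUnit (D 0).det := by
    have : (K.subtype.mapMatrix (D 0)).det ≠ 0 := hdet.ne_zero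
    rw [← RingHom.map_det] at this
    exact isUnit_iff_ne_zero.mpr fun h => this (by rw [h, map_zero])
  obtain ⟨g, hg⟩ := exists_algHom_of_ker_le_comap x hadj D hD0 _ (fun v => aeval_X _ v) hker
  have hgK : ∀ y ∈ K, g y = y := fun y hy => g.commutes ⟨y, hy⟩
  have hgx : ∀ n a b, g (δ^[n] (X a b)) = δ^[n] ((X * B) a b) := fun n a b => by
    have := hg (MvPolynomial.X (n, a, b))
    rw [aeval_iterate_derivation_comp δ X D hD, aeval_X, aeval_X] at this
    exact this
  have hgδ : ∀ y, g (δ y) = δ (g y) := fun y => by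
    have : δ.commSubfield (g : L →+* L) = ⊤ := by
      refine hsub _ (fun z hz => ?_) fun ⟨n, a, b⟩ => ?_
      · change g (δ z) = δ (g z)
        rw [hgK z hz, hgK _ (hKδ z hz)]
      · change g (δ (δ^[n] (X a b))) = δ (g (δ^[n] (X a b)))
        rw [← Function.iterate_succ_apply' δ, hgx, hgx, Function.iterate_succ_apply']
    have hy : y ∈ δ.commSubfield (g : L →+* L) := this ▸ trivial
    exact hy
  have hgX : X.map g = X * B := by ext a b; exact hgx 0 a b
  have hgσ : ∀ y, g (σ y) = σ (g y) := fun y => by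
    have : ((g : L →+* L).comp (σ : L →+* L)).eqLocusField
        ((σ : L →+* L).comp (g : L →+* L)) = ⊤ := by
      refine hgen _ (fun z hz => ?_) (fun i j => ?_) fun z hz => ?_
      · change g (σ z) = σ (g z)
        rw [hgK z (hkK hz), hgK _ (hKσ z (hkK hz))]
      · change g (σ (X i j)) = σ (g (X i j))
        have hgA : A.map g = A := by ext a b; exact hgK _ (hAK a b)
        have hσB : B.map σ = B := by ext a b; exact hσD a b
        have : (X.map σ).map g = (X.map g).map σ := by
          rw [hgX, hσX, Matrix.map_mul, Matrix.map_mul, hgA, hgX, hσX, hσB, mul_assoc]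
        exact congrFun (congrFun this i) j
      · change g (σ z) = σ (g z) at hz
        change g (σ (δ z)) = σ (g (δ z))
        rw [hcomm, hgδ, hgδ, hcomm, hz]
    have hy : y ∈ ((g : L →+* L).comp (σ : L →+* L)).eqLocusField
        ((σ : L →+* L).comp (g : L →+* L)) := this ▸ trivial
    exact hy
  have hsurj : Function.Surjective g := by
    have : (g : L →+* L).fieldRange = ⊤ := by
      refine hgen _ (fun z hz => ⟨z, hgK z (hkK hz)⟩) (fun i j => ?_) ?_
      · have hXB : X = X.map g * B⁻¹ := by
          rw [hgX, Matrix.mul_nonsing_inv_cancel_right _ _ hdet]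
        have hBinv : B⁻¹ = ((D 0)⁻¹).map K.subtype := by
          refine Matrix.inv_eq_right_inv ?_
          have : B = (D 0).map K.subtype := rfl
          rw [this, ← Matrix.map_mul, Matrix.mul_nonsing_inv _ hD0]
          simp
        rw [hXB, hBinv, Matrix.mul_apply]
        exact sum_mem fun c _ => mul_mem ⟨_, rfl⟩ ⟨_, hgK _ ((D 0)⁻¹ c j).2⟩
      · rintro _ ⟨z, rfl⟩
        exact ⟨δ z, hgδ z⟩
    intro y
    have hy : y ∈ (g : L →+* L).fieldRange := this ▸ trivial
    exact hy
  exact ⟨RingEquiv.ofBijective (g : L →+* L) ⟨g.injective, hsurj⟩, hgσ, hgδ, hgK, hgX⟩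

/-- With `k, L = k⟨X, det X⁻¹⟩, σ(X) = AX` as in the Picard–Vessiot
construction, the group `G = Aut_{σδ}(kC_L⟨X⟩/kC_L)` is isomorphic to
`H = {B ∈ GL_m(C_L) : g_B : Y ↦ YB leaves the differential vanishing ideal I_δ of X
invariant}`, the isomorphism sending `g` to `X⁻¹·g(X)` (so `g(X) = X·B_g`), and it is
multiplicative.  An element of `H` is encoded by the sequence `DB` of derivatives of `B`
(entries in `kC_L`, with `B = DB 0` having `σ`-constant entries), and `g_B` acts on the
differential polynomial ring `kC_L{Y}`, realized as `MvPolynomial (ℕ × Fin m × Fin m) kC_L`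
with variable `(n,a,b)` standing for `(Y⁽ⁿ⁾)_{ab}`, by
`Y⁽ⁿ⁾ ↦ ∑_j (n choose j)·Y⁽ⁿ⁻ʲ⁾·B⁽ʲ⁾`. -/
theorem stmt10 {L : Type*} [Field L] [CharZero L]
    (σ : L ≃+* L) (δ : Derivation ℤ L L)
    (hcomm : ∀ x : L, σ (δ x) = δ (σ x))
    (k : Subfield L)
    (hkσ : ∀ x ∈ k, σ x ∈ k) (hkδ : ∀ x ∈ k, δ x ∈ k)
    (hDk : ∀ x ∈ k, (∃ p : Polynomial L, p.Monic ∧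
      (∀ i, p.coeff i ∈ k ∧ σ (p.coeff i) = p.coeff i) ∧ p.eval x = 0) → σ x = x)
    {m : ℕ} (A : Matrix (Fin m) (Fin m) L) (hAk : ∀ i j, A i j ∈ k) (hA : IsUnit A.det)
    (X : Matrix (Fin m) (Fin m) L) (hX : IsUnit X.det)
    (hσX : X.map σ = A * X)
    (hLgen : ∀ F : Subfield L, k ≤ F → (∀ i j, X i j ∈ F) →
      (∀ y ∈ F, δ y ∈ F) → F = ⊤) :
    -- `kC_L`
    letI kCL : Subfield L := Subfield.closure ((k : Set L) ∪ {x | σ x = x})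
    -- the group `G` of `σδ`-automorphisms of `kC_L⟨X⟩ = L` over `kC_L`
    letI Gcond : (L ≃+* L) → Prop := fun g =>
      (∀ x : L, g (σ x) = σ (g x)) ∧ (∀ x : L, g (δ x) = δ (g x)) ∧
        ∀ x ∈ kCL, g x = x
    -- the differential vanishing ideal `I_δ ⊆ kC_L{Y}` of `X`
    letI Iδ : Ideal (MvPolynomial (ℕ × Fin m × Fin m) kCL) :=
      RingHom.ker (MvPolynomial.aeval
        (fun v : ℕ × Fin m × Fin m =>
          ((fun M : Matrix (Fin m) (Fin m) L => M.map δ)^[v.1] X) v.2.1 v.2.2) :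
        MvPolynomial (ℕ × Fin m × Fin m) kCL →ₐ[kCL] L)
    -- the action `g_B : Y⁽ⁿ⁾ ↦ ∑_j (n choose j)·Y⁽ⁿ⁻ʲ⁾·B⁽ʲ⁾`
    letI gB : (ℕ → Matrix (Fin m) (Fin m) kCL) →
        MvPolynomial (ℕ × Fin m × Fin m) kCL →ₐ[kCL]
          MvPolynomial (ℕ × Fin m × Fin m) kCL := fun DB =>
      MvPolynomial.aeval (fun v : ℕ × Fin m × Fin m =>
        ∑ j ∈ Finset.range (v.1 + 1), (v.1.choose j) •
          ∑ c : Fin m, MvPolynomial.C (DB j c v.2.2) *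
            MvPolynomial.X (v.1 - j, v.2.1, c))
    -- membership in `H`
    letI Hcond : (ℕ → Matrix (Fin m) (Fin m) kCL) → Prop := fun DB =>
      (∀ (j : ℕ) (a b : Fin m), ((DB (j + 1) a b : L)) = δ (DB j a b)) ∧
      (∀ a b : Fin m, σ ((DB 0 a b : L)) = (DB 0 a b : L)) ∧
      IsUnit (Matrix.of fun a b : Fin m => ((DB 0 a b : L))).det ∧
      (∀ p ∈ Iδ, gB DB p ∈ Iδ)
    ∃ φ : {g : L ≃+* L // Gcond g} ≃ {DB : ℕ → Matrix (Fin m) (Fin m) kCL // Hcond DB},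
      (∀ g : {g : L ≃+* L // Gcond g},
        X.map ⇑(g.1) = X * Matrix.of fun a b : Fin m => (((φ g).1 0 a b : L))) ∧
      (∀ (g₁ g₂ : {g : L ≃+* L // Gcond g}) (h : Gcond (g₂.1.trans g₁.1)),
        (Matrix.of fun a b : Fin m => (((φ ⟨g₂.1.trans g₁.1, h⟩).1 0 a b : L))) =
          (Matrix.of fun a b : Fin m => (((φ g₁).1 0 a b : L))) *
            (Matrix.of fun a b : Fin m => (((φ g₂).1 0 a b : L)))) := by
  let kCL : Subfield L := Subfield.closure ((k : Set L) ∪ {x | σ x = x})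
  let Gcond : (L ≃+* L) → Prop := fun g =>
    (∀ x : L, g (σ x) = σ (g x)) ∧ (∀ x : L, g (δ x) = δ (g x)) ∧ ∀ x ∈ kCL, g x = x
  let Iδ : Ideal (MvPolynomial (ℕ × Fin m × Fin m) kCL) :=
    RingHom.ker (MvPolynomial.aeval
      (fun v : ℕ × Fin m × Fin m =>
        ((fun M : Matrix (Fin m) (Fin m) L => M.map δ)^[v.1] X) v.2.1 v.2.2) :
      MvPolynomial (ℕ × Fin m × Fin m) kCL →ₐ[kCL] L)
  let gB : (ℕ → Matrix (Fin m) (Fin m) kCL) →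
      MvPolynomial (ℕ × Fin m × Fin m) kCL →ₐ[kCL] MvPolynomial (ℕ × Fin m × Fin m) kCL := fun DB =>
    MvPolynomial.aeval (fun v : ℕ × Fin m × Fin m =>
      ∑ j ∈ Finset.range (v.1 + 1), (v.1.choose j) •
        ∑ c : Fin m, MvPolynomial.C (DB j c v.2.2) * MvPolynomial.X (v.1 - j, v.2.1, c))
  let Hcond : (ℕ → Matrix (Fin m) (Fin m) kCL) → Prop := fun DB =>
    (∀ (j : ℕ) (a b : Fin m), ((DB (j + 1) a b : L)) = δ (DB j a b)) ∧
    (∀ a b : Fin m, σ ((DB 0 a b : L)) = (DB 0 a b : L)) ∧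
    IsUnit (Matrix.of fun a b : Fin m => ((DB 0 a b : L))).det ∧ (∀ p ∈ Iδ, gB DB p ∈ Iδ)
  have hkK : k ≤ kCL := fun x hx => Subfield.subset_closure (.inl hx)
  have hCK : ∀ x, σ x = x → x ∈ kCL := fun x hx => Subfield.subset_closure (.inr hx)
  have hKσ : ∀ x ∈ kCL, σ x ∈ kCL := fun x hx => by
    have : kCL ≤ kCL.comap (σ : L →+* L) := Subfield.closure_le.mpr fun y hy => by
      rcases hy with hy | hy
      · exact hkK (hkσ y hy)
      · exact hCK _ (congrArg σ hy)
    exact this hx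
  have hCδ : ∀ x, σ x = x → σ (δ x) = δ x := fun x hx => by rw [hcomm, hx]
  have hKδ : ∀ x ∈ kCL, δ x ∈ kCL := fun x hx => δ.apply_mem_closure _ (fun y hy => by
    rcases hy with hy | hy
    · exact hkK (hkδ y hy)
    · exact hCK _ (hCδ y hy)) hx
  have hIδ : ∀ p, p ∈ Iδ ↔ MvPolynomial.aeval
      (fun v : ℕ × Fin m × Fin m => δ^[v.1] (X v.2.1 v.2.2)) p = 0 := fun p => by
    simp only [Iδ, RingHom.mem_ker, Matrix.iterate_map_apply]
  have hσB : ∀ g : L ≃+* L, Gcond g → ∀ a b,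
      σ ((X⁻¹ * X.map g) a b) = (X⁻¹ * X.map g) a b := fun g hg a b =>
    congrFun (congrFun (Matrix.map_inv_mul_map_eq σ g hg.1 A X hA hX hσX
      (by ext i j; exact hg.2.2 _ (hkK (hAk i j)))) a) b
  have hσBδ : ∀ g : L ≃+* L, Gcond g → ∀ j a b,
      σ (δ^[j] ((X⁻¹ * X.map g) a b)) = δ^[j] ((X⁻¹ * X.map g) a b) := fun g hg j a b => by
    induction j with
    | zero => exact hσB g hg a b
    | succ j ih => rw [Function.iterate_succ_apply', hCδ _ ih]
  have hmul : ∀ g : L ≃+* L, X * (X⁻¹ * X.map g) = X.map g := fun g =>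
    Matrix.mul_nonsing_inv_cancel_left _ _ hX
  let D : {g : L ≃+* L // Gcond g} → ℕ → Matrix (Fin m) (Fin m) kCL := fun g j =>
    Matrix.of fun a b => ⟨δ^[j] ((X⁻¹ * X.map g.1) a b), hCK _ (hσBδ g.1 g.2 j a b)⟩
  have hDδ : ∀ g j a b, (D g (j + 1) a b : L) = δ (D g j a b) := fun g j a b =>
    Function.iterate_succ_apply' _ _ _
  have hXD : ∀ g : {g : L ≃+* L // Gcond g},
      X.map g.1 = X * Matrix.of fun a b => (D g 0 a b : L) := fun g => (hmul g.1).symm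
  have hDH : ∀ g, Hcond (D g) := fun g => by
    refine ⟨hDδ g, fun a b => hσB g.1 g.2 a b, ?_, fun p hp => ?_⟩
    · have h : (X.map g.1).det ≠ 0 := by
        have : (X.map g.1).det = g.1 X.det := (RingEquiv.map_det g.1 X).symm
        rw [this]
        exact (map_ne_zero_iff _ g.1.injective).mpr hX.ne_zero
      rw [hXD, Matrix.det_mul] at h
      exact isUnit_iff_ne_zero.mpr (right_ne_zero_of_mul h)
    · rw [hIδ] at hp ⊢
      refine (MvPolynomial.aeval_iterate_derivation_comp δ X (D g) (hDδ g) p).trans ?_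
      rw [← hXD]
      let g' : L →ₐ[kCL] L := { (g.1 : L →+* L) with commutes' := fun r => g.2.2.2 r r.2 }
      have hiter : ∀ n y, δ^[n] (g.1 y) = g.1 (δ^[n] y) := fun n y =>
        ((Function.Commute.iterate_right (f := g.1) (g := δ) g.2.2.1 n) y).symm
      have : (fun v : ℕ × Fin m × Fin m => δ^[v.1] ((X.map g.1) v.2.1 v.2.2)) =
          fun v => g' (δ^[v.1] (X v.2.1 v.2.2)) := funext fun v => hiter _ _
      rw [this, ← MvPolynomial.comp_aeval_apply, hp, map_zero]
  refine ⟨Equiv.ofBijective (fun g => ⟨D g, hDH g⟩) ⟨fun g h hgh => ?_, fun E => ?_⟩, hXD,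
    fun g₁ g₂ h => ?_⟩
  · refine Subtype.ext (RingEquiv.eq_of_eqOn_differential_generators δ k X hLgen g.1 h.1
      g.2.2.1 h.2.2.1 (fun x hx => ?_) ?_)
    · rw [g.2.2.2 x (hkK hx), h.2.2.2 x (hkK hx)]
    · rw [hXD g, hXD h, show D g = D h from congrArg Subtype.val hgh]
  · obtain ⟨E, hE⟩ := E
    obtain ⟨g, hgσ, hgδ, hgK, hgX⟩ := exists_ringEquiv_of_preserves_vanishing σ δ hcomm k kCL hkK
      hKσ hKδ A X (fun i j => hkK (hAk i j)) hσX hLgen E hE.1 hE.2.1 hE.2.2.1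
      fun p hp => (hIδ _).mp (hE.2.2.2 p ((hIδ p).mpr hp))
    refine ⟨⟨g, hgσ, hgδ, hgK⟩, Subtype.ext (funext fun j => ?_)⟩
    ext a b
    induction j generalizing a b with
    | zero =>
      change (X⁻¹ * X.map g) a b = E 0 a b
      rw [hgX, Matrix.nonsing_inv_mul_cancel_left _ _ hX, Matrix.of_apply]
    | succ j ih =>
      rw [hE.1, ← ih]
      exact hDδ _ j a b
  · have hg₁ : (Matrix.of fun a b => (D g₂ 0 a b : L)).map g₁.1 =
        Matrix.of fun a b => (D g₂ 0 a b : L) := by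
      ext a b
      exact g₁.2.2.2 _ (D g₂ 0 a b).2
    have hcomp : X * (Matrix.of fun a b => (D ⟨g₂.1.trans g₁.1, h⟩ 0 a b : L)) =
        X * ((Matrix.of fun a b => (D g₁ 0 a b : L)) *
          Matrix.of fun a b => (D g₂ 0 a b : L)) := by
      rw [← hXD, ← mul_assoc, ← hXD g₁]
      have : X.map (g₂.1.trans g₁.1) = (X.map g₂.1).map g₁.1 := rfl
      rw [this, hXD g₂, Matrix.map_mul, hg₁]
    have := congrArg (X⁻¹ * ·) hcomp
    simp only [Matrix.nonsing_inv_mul_cancel_left _ _ hX] at this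
    exact this
end

section
/- With notation as in the Galois group description, a matrix B ∈ GL_m(C_L) lies in the differential Galois group ℍ if and only if for every n ∈ ℕ, the block matrix (B, B', …, B⁽ⁿ⁾) (lower-triangular with blocks B⁽ⁱ⁻ʲ⁾) lies in the algebraic Galois group ℍ_n of the associated order-n difference system. Moreover, by noetherianity of the Kolchin topology, there exists n₀ such that membership for all n ≤ n₀ suffices. -/
open Polynomial in
/-- An element that is not a simple root of any polynomial over `R` is transcendental over `R`. -/
theorem eq_zero_of_aeval_eq_zero_of_forall_derivative {R L : Type*} [CommRing R] [Field L]
    [CharZero L] [Algebra R L] [FaithfulSMul R L] (a : L)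
    (h : ∀ f : R[X], aeval a f = 0 → aeval a (derivative f) = 0) (f : R[X])
    (hf : aeval a f = 0) : f = 0 := by
  have hinj := FaithfulSMul.algebraMap_injective R L
  have : IsDomain R := hinj.isDomain (algebraMap R L)
  have : CharZero R := (algebraMap R L).charZero
  induction hn : f.natDegree using Nat.strong_induction_on generalizing f with
  | _ n ih =>
    by_cases h0 : f.natDegree = 0
    · rw [eq_C_of_natDegree_eq_zero h0] at hf ⊢
      rw [aeval_C] at hf
      rw [(map_eq_zero_iff _ hinj).1 hf, C_0]
    · have hlt := natDegree_derivative_lt h0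
      have hd := ih _ (hn ▸ hlt) (derivative f) (h f hf) rfl
      exact absurd (derivative_eq_zero.1 hd) h0

section Segment

variable (K : Type*) {M : Type*} [Field K] [CommRing M] [Algebra K M]

/-- The subalgebra generated by the first `v` terms of a sequence. -/
def initialAlg (z : ℕ → M) (v : ℕ) : Subalgebra K M :=
  Algebra.adjoin K (z '' Set.Iio v)

variable {K}

theorem initialAlg_mono (z : ℕ → M) {v w : ℕ} (h : v ≤ w) :
    initialAlg K z v ≤ initialAlg K z w :=
  Algebra.adjoin_mono (Set.image_mono (Set.Iio_subset_Iio h))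

theorem mem_initialAlg (z : ℕ → M) {v w : ℕ} (h : v < w) : z v ∈ initialAlg K z w :=
  Algebra.subset_adjoin ⟨v, h, rfl⟩

theorem map_initialAlg {N : Type*} [CommRing N] [Algebra K N] (φ : M →ₐ[K] N) (z : ℕ → M)
    (v : ℕ) : (initialAlg K z v).map φ = initialAlg K (fun i => φ (z i)) v := by
  rw [initialAlg, AlgHom.map_adjoin, initialAlg, Set.image_image]

open Polynomial in
theorem exists_aeval_eq_of_mem_initialAlg_succ (z : ℕ → M) (v : ℕ) {a : M}
    (ha : a ∈ initialAlg K z (v + 1)) : ∃ f : (initialAlg K z v)[X], aeval (z v) f = a := by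
  induction ha using Algebra.adjoin_induction with
  | mem a ha =>
    obtain ⟨w, hw, rfl⟩ := ha
    rcases Nat.lt_succ_iff_lt_or_eq.1 hw with h | rfl
    · exact ⟨C ⟨z w, mem_initialAlg z h⟩, by rw [aeval_C]; rfl⟩
    · exact ⟨X, aeval_X _⟩
  | algebraMap r => exact ⟨C (algebraMap K _ r), by rw [aeval_C]; rfl⟩
  | add a b _ _ iha ihb =>
    obtain ⟨f, rfl⟩ := iha
    obtain ⟨g, rfl⟩ := ihb
    exact ⟨f + g, map_add _ _ _⟩
  | mul a b _ _ iha ihb =>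
    obtain ⟨f, rfl⟩ := iha
    obtain ⟨g, rfl⟩ := ihb
    exact ⟨f * g, map_mul _ _ _⟩

open Polynomial in
theorem aeval_mem_initialAlg_succ (z : ℕ → M) (v : ℕ) (f : (initialAlg K z v)[X]) :
    aeval (z v) f ∈ initialAlg K z (v + 1) := by
  rw [aeval_eq_sum_range]
  refine sum_mem fun i _ => ?_
  rw [Algebra.smul_def]
  exact mul_mem (initialAlg_mono z (Nat.le_succ v) (f.coeff i).2)
    (pow_mem (mem_initialAlg z (Nat.lt_succ_self v)) i)

/-- If `S * z v` lies in the algebra of lower terms, then so does a multiple by a power of `S` of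
each element of the next algebra. -/
theorem exists_pow_mul_mem_initialAlg (z : ℕ → M) (v : ℕ) {S : M} (hS : S ∈ initialAlg K z v)
    (hT : S * z v ∈ initialAlg K z v) {a : M} (ha : a ∈ initialAlg K z (v + 1)) :
    ∃ d : ℕ, S ^ d * a ∈ initialAlg K z v := by
  induction ha using Algebra.adjoin_induction with
  | mem a ha =>
    obtain ⟨w, hw, rfl⟩ := ha
    rcases Nat.lt_succ_iff_lt_or_eq.1 hw with h | rfl
    · exact ⟨0, by simpa using mem_initialAlg z h⟩
    · exact ⟨1, by simpa using hT⟩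
  | algebraMap r => exact ⟨0, by simp⟩
  | add a b _ _ iha ihb =>
    obtain ⟨d, hd⟩ := iha
    obtain ⟨e, he⟩ := ihb
    refine ⟨d + e, ?_⟩
    have : S ^ (d + e) * (a + b) = S ^ e * (S ^ d * a) + S ^ d * (S ^ e * b) := by ring
    rw [this]
    exact add_mem (mul_mem (pow_mem hS _) hd) (mul_mem (pow_mem hS _) he)
  | mul a b _ _ iha ihb =>
    obtain ⟨d, hd⟩ := iha
    obtain ⟨e, he⟩ := ihb
    refine ⟨d + e, ?_⟩
    have : S ^ (d + e) * (a * b) = (S ^ d * a) * (S ^ e * b) := by ring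
    rw [this]
    exact mul_mem hd he

variable {Δ : Derivation ℤ M M} {z : ℕ → M} {r : ℕ}

theorem derivation_mem_initialAlg (hK : ∀ c : K, Δ (algebraMap K M c) ∈ Set.range (algebraMap K M))
    (hz : ∀ v, Δ (z v) = z (v + r)) (v : ℕ) {a : M} (ha : a ∈ initialAlg K z v) :
    Δ a ∈ initialAlg K z (v + r) := by
  have hle := initialAlg_mono (K := K) z (Nat.le_add_right v r)
  induction ha using Algebra.adjoin_induction with
  | mem a ha =>
    obtain ⟨w, hw, rfl⟩ := ha
    rw [hz]
    exact mem_initialAlg z (Nat.add_lt_add_right hw r)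
  | algebraMap c =>
    obtain ⟨d, hd⟩ := hK c
    rw [← hd]
    exact Subalgebra.algebraMap_mem _ d
  | add a b _ _ iha ihb => rw [map_add]; exact add_mem iha ihb
  | mul a b ha hb iha ihb =>
    rw [Derivation.leibniz, smul_eq_mul, smul_eq_mul]
    exact add_mem (mul_mem (hle ha) ihb) (mul_mem (hle hb) iha)

open Polynomial in
theorem derivation_aeval_sub_mem_initialAlg
    (hK : ∀ c : K, Δ (algebraMap K M c) ∈ Set.range (algebraMap K M))
    (hr : 0 < r) (hz : ∀ v, Δ (z v) = z (v + r)) (u : ℕ) (f : (initialAlg K z u)[X]) :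
    Δ (aeval (z u) f) - aeval (z u) (derivative f) * z (u + r) ∈ initialAlg K z (u + r) := by
  induction f using Polynomial.induction_on' with
  | add p q hp hq =>
    have := add_mem hp hq
    rw [map_add, map_add, map_add, map_add]
    convert this using 1
    ring
  | monomial n a =>
    rw [aeval_monomial, derivative_monomial, aeval_monomial, Derivation.leibniz,
      Derivation.leibniz_pow, hz, map_mul, map_natCast]
    have : algebraMap (initialAlg K z u) M a • n • z u ^ (n - 1) • z (u + r) +
        z u ^ n • Δ (algebraMap (initialAlg K z u) M a) -
        algebraMap (initialAlg K z u) M a * (n : M) * z u ^ (n - 1) * z (u + r) =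
        z u ^ n * Δ (a : M) := by
      simp only [smul_eq_mul, nsmul_eq_mul]
      change _ + z u ^ n * Δ (a : M) - _ = _
      ring
    rw [this]
    exact mul_mem (pow_mem (mem_initialAlg z (by omega)) n)
      (derivation_mem_initialAlg hK hz u a.2)

open Polynomial in
/-- Every derivative of an algebraic relation is linear in its highest term, with the separant
as coefficient. -/
theorem separant_mul_mem_initialAlg
    (hK : ∀ c : K, Δ (algebraMap K M c) ∈ Set.range (algebraMap K M))
    (hr : 0 < r) (hz : ∀ v, Δ (z v) = z (v + r)) (u : ℕ) (f : (initialAlg K z u)[X])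
    (hf : aeval (z u) f = 0) (n : ℕ) :
    aeval (z u) (derivative f) * z (u + (n + 1) * r) ∈ initialAlg K z (u + (n + 1) * r) := by
  induction n with
  | zero =>
    have := derivation_aeval_sub_mem_initialAlg hK hr hz u f
    rw [hf, map_zero, zero_sub] at this
    simpa using neg_mem this
  | succ n ih =>
    set S := aeval (z u) (derivative f)
    have hS : S ∈ initialAlg K z (u + 1) := aeval_mem_initialAlg_succ z u _
    have h1 := derivation_mem_initialAlg hK hz _ ih
    have h2 := derivation_mem_initialAlg hK hz _ hS
    have e : u + (n + 1 + 1) * r = u + (n + 1) * r + r := by ring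
    rw [Derivation.leibniz, smul_eq_mul, smul_eq_mul, hz] at h1
    rw [e]
    have h3 : z (u + (n + 1) * r) * Δ S ∈ initialAlg K z (u + (n + 1) * r + r) :=
      mul_mem (mem_initialAlg z (by omega))
        (initialAlg_mono z (by nlinarith) h2)
    simpa using sub_mem h1 h3

end Segment

/-- The componentwise derivation on a product ring. -/
def prodDerivation {L : Type*} [CommRing L] (δ : Derivation ℤ L L) :
    Derivation ℤ (L × L) (L × L) :=
  Derivation.mk' ((δ : L →ₗ[ℤ] L).prodMap (δ : L →ₗ[ℤ] L)) fun a b => by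
    ext <;> simp

theorem prodDerivation_apply {L : Type*} [CommRing L] (δ : Derivation ℤ L L) (a : L × L) :
    prodDerivation δ a = (δ a.1, δ a.2) := rfl

section Pair

variable {K L : Type*} [Field K] [Field L] [Algebra K L]

/-- The projection of the algebra generated by initial terms of a sequence of pairs. -/
def initialAlgFst (x y : ℕ → L) (v : ℕ) :
    initialAlg K (fun i => (x i, y i)) v →+* initialAlg K x v :=
  (((AlgHom.fst K L L).comp (initialAlg K (fun i => (x i, y i)) v).val).codRestrict
    (initialAlg K x v) fun a => by
      have : (a : L × L).1 ∈ (initialAlg K (fun i => (x i, y i)) v).map (AlgHom.fst K L L) :=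
        ⟨a, a.2, rfl⟩
      rwa [map_initialAlg (AlgHom.fst K L L)] at this).toRingHom

theorem initialAlgFst_surjective (x y : ℕ → L) (v : ℕ) :
    Function.Surjective (initialAlgFst (K := K) x y v) := by
  rintro ⟨a, ha⟩
  have h := map_initialAlg (AlgHom.fst K L L) (fun i => (x i, y i)) v
  rw [show initialAlg K x v = _ from h.symm] at ha
  obtain ⟨b, hb, rfl⟩ := ha
  exact ⟨⟨b, hb⟩, rfl⟩

open Polynomial in
theorem aeval_map_initialAlgFst (x y : ℕ → L) (v : ℕ)
    (f : (initialAlg K (fun i => (x i, y i)) v)[X]) :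
    aeval (x v) (f.map (initialAlgFst x y v)) =
      (aeval ((x v, y v) : L × L) f).1 := by
  rw [aeval_def, aeval_def, eval₂_map, ← RingHom.coe_fst, hom_eval₂]
  rfl

open Polynomial in
theorem forall_initialAlg_snd_eq_zero [CharZero L] (δ : Derivation ℤ L L)
    (hK : ∀ c : K, ∃ d : K, δ (algebraMap K L c) = algebraMap K L d)
    {r : ℕ} (hr : 0 < r) (x : ℕ → L) (hx : ∀ v, δ (x v) = x (v + r)) :
    ∃ N : ℕ, ∀ y : ℕ → L, (∀ v, δ (y v) = y (v + r)) →
      (∀ a ∈ initialAlg K (fun i => (x i, y i)) N, a.1 = 0 ↔ a.2 = 0) →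
      ∀ v, ∀ a ∈ initialAlg K (fun i => (x i, y i)) v, a.1 = 0 → a.2 = 0 := by
  classical
  let leader : ℕ → Prop := fun u => ∃ f : (initialAlg K x u)[X],
    aeval (x u) f = 0 ∧ aeval (x u) (derivative f) ≠ 0
  have hex : ∀ c : ℕ, ∃ b : ℕ, (∃ u, leader u ∧ u % r = c) → ∃ u ≤ b, leader u ∧ u % r = c := by
    intro c
    by_cases h : ∃ u, leader u ∧ u % r = c
    · obtain ⟨u, hu⟩ := h
      exact ⟨u, fun _ => ⟨u, le_rfl, hu⟩⟩
    · exact ⟨0, fun h' => absurd h' h⟩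
  choose b hb using hex
  set N₀ := (Finset.range r).sup b
  refine ⟨N₀ + 1, fun y hy hN v => ?_⟩
  set z : ℕ → L × L := fun i => (x i, y i)
  have hz : ∀ v, prodDerivation δ (z v) = z (v + r) := fun v => by
    rw [prodDerivation_apply]
    exact Prod.ext (hx v) (hy v)
  have hK' : ∀ c : K, prodDerivation δ (algebraMap K (L × L) c) ∈
      Set.range (algebraMap K (L × L)) := fun c => by
    obtain ⟨d, hd⟩ := hK c
    exact ⟨d, Prod.ext hd.symm hd.symm⟩
  induction v with
  | zero => exact fun a ha h => (hN a (initialAlg_mono z (Nat.zero_le _) ha)).1 h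
  | succ v ih =>
    intro a ha h
    by_cases hvN : v + 1 ≤ N₀ + 1
    · exact (hN a (initialAlg_mono z hvN ha)).1 h
    by_cases hlead : leader v
    · obtain ⟨u, hub, ⟨g, hg0, hg1⟩, hmod⟩ := hb (v % r) ⟨v, hlead, rfl⟩
      have huN : u ≤ N₀ :=
        hub.trans (Finset.le_sup (f := b) (Finset.mem_range.2 (Nat.mod_lt v hr)))
      obtain ⟨f, rfl⟩ := Polynomial.map_surjective
        (initialAlgFst x y u) (initialAlgFst_surjective x y u) g
      rw [derivative_map, aeval_map_initialAlgFst] at hg1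
      rw [aeval_map_initialAlgFst] at hg0
      have hmem : ∀ p : (initialAlg K z u)[X], aeval (z u) p ∈ initialAlg K z (N₀ + 1) :=
        fun p => initialAlg_mono z (by omega) (aeval_mem_initialAlg_succ z u p)
      have hf : aeval (z u) f = 0 := Prod.ext hg0 ((hN _ (hmem f)).1 hg0)
      have hS2 := mt (hN _ (hmem (derivative f))).2 hg1
      obtain ⟨n, rfl⟩ : ∃ n, v = u + (n + 1) * r := by
        have h1 : u < v := by omega
        obtain ⟨m, hm⟩ := (Nat.modEq_iff_dvd' h1.le).1 hmod
        have hm0 : m ≠ 0 := by rintro rfl; omega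
        obtain ⟨n, rfl⟩ := Nat.exists_eq_succ_of_ne_zero hm0
        exact ⟨n, by rw [Nat.succ_eq_add_one, mul_comm] at hm; omega⟩
      have hT := separant_mul_mem_initialAlg hK' hr hz u f hf n
      obtain ⟨d, hd⟩ := exists_pow_mul_mem_initialAlg z _
        (initialAlg_mono z (by nlinarith) (aeval_mem_initialAlg_succ z u (derivative f))) hT ha
      have h2 := ih _ hd (by rw [Prod.fst_mul, h, mul_zero])
      rw [Prod.snd_mul, Prod.pow_snd] at h2
      exact (mul_eq_zero.1 h2).resolve_left (pow_ne_zero _ hS2)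
    · obtain ⟨f, rfl⟩ := exists_aeval_eq_of_mem_initialAlg_succ z v ha
      have hf : f.map (initialAlgFst x y v) = 0 := by
        refine eq_zero_of_aeval_eq_zero_of_forall_derivative (x v) (fun p hp => ?_) _
          ((aeval_map_initialAlgFst x y v f).trans h)
        by_contra hne
        exact hlead ⟨p, hp, hne⟩
      have hc : ∀ i, (f.coeff i : L × L).2 = 0 := fun i => by
        refine ih _ (f.coeff i).2 ?_
        have := congrArg (fun p : (initialAlg K x v)[X] => ((p.coeff i : initialAlg K x v) : L)) hf
        rw [coeff_map] at this
        exact this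
      rw [aeval_eq_sum_range, Prod.snd_sum]
      refine Finset.sum_eq_zero fun i _ => ?_
      rw [Algebra.smul_def, Prod.snd_mul]
      exact mul_eq_zero_of_left (hc i) _

end Pair

open MvPolynomial in
/-- Two tuples satisfying the same algebraic relations between derivatives up to a certain order,
depending only on the first of them, satisfy the same relations in all orders. -/
theorem exists_order_forall_aeval_eq_zero {K L ι : Type*} [Field K] [Field L] [Algebra K L]
    [CharZero L] [Fintype ι] (δ : Derivation ℤ L L)
    (hK : ∀ c : K, ∃ d : K, δ (algebraMap K L c) = algebraMap K L d) (x : ι → L) :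
    ∃ N : ℕ, ∀ y : ι → L,
      (∀ p : MvPolynomial (Fin (N + 1) × ι) K,
        aeval (fun w : Fin (N + 1) × ι => δ^[(w.1 : ℕ)] (x w.2)) p = 0 ↔
        aeval (fun w : Fin (N + 1) × ι => δ^[(w.1 : ℕ)] (y w.2)) p = 0) →
      ∀ p : MvPolynomial (ℕ × ι) K,
        aeval (fun w : ℕ × ι => δ^[w.1] (x w.2)) p = 0 →
        aeval (fun w : ℕ × ι => δ^[w.1] (y w.2)) p = 0 := by
  rcases isEmpty_or_nonempty ι with hι | hι
  · exact ⟨0, fun y _ p hp => by rwa [Subsingleton.elim y x]⟩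
  let r := Fintype.card ι
  have hr : 0 < r := Fintype.card_pos
  let e : ι ≃ Fin r := Fintype.equivFin ι
  let s : (ι → L) → ℕ → L := fun x v => δ^[v / r] (x (e.symm ⟨v % r, Nat.mod_lt v hr⟩))
  have hs : ∀ (x : ι → L) v, δ (s x v) = s x (v + r) := fun x v => by
    simp only [s, Nat.add_div_right v hr, Nat.add_mod_right, Function.iterate_succ_apply']
  have hs' : ∀ (x : ι → L) (w : ℕ × ι), δ^[w.1] (x w.2) = s x (e w.2 + r * w.1) := fun x w => by
    simp [s, Nat.add_mul_div_left _ _ hr, Nat.div_eq_of_lt, Nat.mod_eq_of_lt]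
  obtain ⟨N, hN⟩ := forall_initialAlg_snd_eq_zero δ hK hr (s x) (hs x)
  refine ⟨N, fun y hy p hp => ?_⟩
  have hfst : ∀ {τ : Type _} (f : τ → L × L) (q : MvPolynomial τ K),
      (aeval f q).1 = aeval (fun i => (f i).1) q := fun f q =>
    comp_aeval_apply f (AlgHom.fst K L L) q
  have hsnd : ∀ {τ : Type _} (f : τ → L × L) (q : MvPolynomial τ K),
      (aeval f q).2 = aeval (fun i => (f i).2) q := fun f q =>
    comp_aeval_apply f (AlgHom.snd K L L) q
  have key := hN (s y) (hs y) fun a ha => by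
    have hle : initialAlg K (fun i => (s x i, s y i)) N ≤
        (aeval (R := K) fun w : Fin (N + 1) × ι =>
          (δ^[(w.1 : ℕ)] (x w.2), δ^[(w.1 : ℕ)] (y w.2))).range := by
      refine Algebra.adjoin_le ?_
      rintro _ ⟨v, hv, rfl⟩
      have : v / r < N + 1 := (Nat.div_le_self v r).trans_lt (lt_trans hv (Nat.lt_succ_self N))
      exact ⟨X (⟨v / r, this⟩, e.symm ⟨v % r, Nat.mod_lt v hr⟩), aeval_X _ _⟩
    obtain ⟨q, rfl⟩ := hle ha
    have := hy q
    rw [← hfst (fun w : Fin (N + 1) × ι => (δ^[(w.1 : ℕ)] (x w.2), δ^[(w.1 : ℕ)] (y w.2))),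
      ← hsnd (fun w : Fin (N + 1) × ι => (δ^[(w.1 : ℕ)] (x w.2), δ^[(w.1 : ℕ)] (y w.2)))] at this
    exact this
  have hmem : ∀ q : MvPolynomial (ℕ × ι) K, ∃ v,
      aeval (fun w : ℕ × ι => (δ^[w.1] (x w.2), δ^[w.1] (y w.2))) q ∈
        initialAlg K (fun i => (s x i, s y i)) v := by
    intro q
    induction q using MvPolynomial.induction_on with
    | C c => exact ⟨0, by rw [aeval_C]; exact Subalgebra.algebraMap_mem _ c⟩
    | add p q hp hq =>
      obtain ⟨v, hv⟩ := hp
      obtain ⟨w, hw⟩ := hq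
      refine ⟨max v w, ?_⟩
      rw [map_add]
      exact add_mem (initialAlg_mono _ (le_max_left v w) hv)
        (initialAlg_mono _ (le_max_right v w) hw)
    | mul_X p w hp =>
      obtain ⟨v, hv⟩ := hp
      refine ⟨max v (e w.2 + r * w.1 + 1), ?_⟩
      rw [map_mul, aeval_X, hs', hs']
      exact mul_mem (initialAlg_mono _ (le_max_left _ _) hv)
        (mem_initialAlg (fun i => (s x i, s y i))
          (lt_of_lt_of_le (Nat.lt_succ_self _) (le_max_right _ _)))
  obtain ⟨v, hv⟩ := hmem p
  have := key v _ hv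
  rw [hfst, hsnd] at this
  exact this hp

/-- The general Leibniz rule for iterated derivations. -/
theorem derivation_iterate_mul {L : Type*} [CommRing L] (δ : Derivation ℤ L L) (n : ℕ) (a b : L) :
    δ^[n] (a * b) = ∑ j ∈ Finset.range (n + 1), n.choose j • (δ^[j] b * δ^[n - j] a) := by
  rw [← Finset.Nat.sum_antidiagonal_eq_sum_range_succ
    (fun i j => n.choose i • (δ^[i] b * δ^[j] a))]
  induction n with
  | zero => simp [mul_comm]
  | succ n ih =>
    rw [Finset.sum_antidiagonal_choose_succ_nsmul (fun i j => δ^[i] b * δ^[j] a) n,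
      Function.iterate_succ_apply', ih]
    simp only [map_sum, map_nsmul, Derivation.leibniz, smul_eq_mul, smul_add,
      Finset.sum_add_distrib, Function.iterate_succ_apply']
    congr 1
    refine Finset.sum_congr rfl fun ij hij => ?_
    rw [Nat.choose_symm_of_eq_add (Finset.HasAntidiagonal.mem_antidiagonal.1 hij).symm, mul_comm]

/-- An ideal stable under a surjective endomorphism of a noetherian ring equals its preimage. -/
theorem comap_le_of_le_comap_of_surjective {R : Type*} [CommRing R] [IsNoetherianRing R]
    (g : R →+* R) (hg : Function.Surjective g) {I : Ideal R} (h : I ≤ I.comap g) :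
    I.comap g ≤ I := by
  have hmono : Monotone (Ideal.comap g) := fun _ _ h => Ideal.comap_mono h
  let f : ℕ →o Ideal R := ⟨fun n => (Ideal.comap g)^[n] I, monotone_nat_of_le_succ fun n => by
    rw [Function.iterate_succ_apply]
    exact hmono.iterate n h⟩
  obtain ⟨n, hn⟩ := monotone_stabilizes_iff_noetherian.2 ‹IsNoetherianRing R› f
  have := hn (n + 1) (Nat.le_succ n)
  change (Ideal.comap g)^[n] I = (Ideal.comap g)^[n + 1] I at this
  rw [Function.iterate_succ_apply] at this
  exact ((Ideal.comap_injective_of_surjective g hg).iterate n this).ge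

theorem iterate_matrix_map_apply {ι κ L : Type*} (f : L → L) (X : Matrix ι κ L) (n : ℕ) (i : ι)
    (j : κ) : ((fun M : Matrix ι κ L => M.map f)^[n] X) i j = f^[n] (X i j) := by
  induction n with
  | zero => rfl
  | succ n ih => rw [Function.iterate_succ_apply', Function.iterate_succ_apply', ← ih]; rfl

section Action

open MvPolynomial

variable {K L : Type*} [Field K] [Field L] [Algebra K L] {m : ℕ}

/-- The action of a matrix, given by its derivatives, on differential polynomials. -/
noncomputable def jetAction (D : ℕ → Matrix (Fin m) (Fin m) K) :
    MvPolynomial (ℕ × Fin m × Fin m) K →ₐ[K] MvPolynomial (ℕ × Fin m × Fin m) K :=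
  aeval fun v => ∑ j ∈ Finset.range (v.1 + 1), (v.1.choose j) •
    ∑ c : Fin m, C (D j c v.2.2) * X (v.1 - j, v.2.1, c)

/-- The action of a matrix, given by its derivatives, on differential polynomials of order at
most `n`. -/
noncomputable def truncJetAction (n : ℕ) (D : ℕ → Matrix (Fin m) (Fin m) K) :
    MvPolynomial (Fin (n + 1) × Fin m × Fin m) K →ₐ[K]
      MvPolynomial (Fin (n + 1) × Fin m × Fin m) K :=
  aeval fun v => ∑ j ∈ Finset.range ((v.1 : ℕ) + 1), ((v.1 : ℕ).choose j) •
    ∑ c : Fin m, C (D j c v.2.2) *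
      X (Fin.mk ((v.1 : ℕ) - j) (Nat.lt_of_le_of_lt (Nat.sub_le _ _) v.1.isLt), v.2.1, c)

theorem truncJetAction_surjective (n : ℕ) (D : ℕ → Matrix (Fin m) (Fin m) K)
    (hD : IsUnit (D 0).det) : Function.Surjective (truncJetAction n D) := by
  have hX : ∀ (i : ℕ) (hi : i < n + 1) (a b : Fin m),
      (X (⟨i, hi⟩, a, b) : MvPolynomial (Fin (n + 1) × Fin m × Fin m) K) ∈
        (truncJetAction n D).range := by
    intro i
    induction i using Nat.strong_induction_on with
    | _ i ih =>
      intro hi a b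
      have hrow : ∀ b, ∑ c : Fin m, C (D 0 c b) *
          (X (⟨i, hi⟩, a, c) : MvPolynomial (Fin (n + 1) × Fin m × Fin m) K) ∈
            (truncJetAction n D).range := by
        intro b
        have h1 : truncJetAction n D (X (⟨i, hi⟩, a, b)) ∈ (truncJetAction n D).range := ⟨_, rfl⟩
        rw [truncJetAction, aeval_X, Finset.sum_range_succ', ← truncJetAction] at h1
        refine (add_mem_cancel_left (sum_mem fun j hj => ?_)).1 (by simpa only [Nat.choose_zero_right, one_smul, Nat.sub_zero] using h1)
        have hj' : j < i := Finset.mem_range.1 hj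
        refine nsmul_mem (sum_mem fun c _ => mul_mem ?_ (ih _ (by omega) _ _ _)) _
        exact Subalgebra.algebraMap_mem _ _
      have hinv : (X (⟨i, hi⟩, a, b) : MvPolynomial (Fin (n + 1) × Fin m × Fin m) K) =
          ∑ d, C ((D 0)⁻¹ d b) * ∑ c, C (D 0 c d) * X (⟨i, hi⟩, a, c) := by
        have h2 := congrArg (fun M : Matrix (Fin m) (Fin m) K => fun c => M c b)
          (Matrix.mul_nonsing_inv (D 0) hD)
        simp only [Finset.mul_sum]
        rw [Finset.sum_comm]
        have h3 : ∀ c, ∑ d, C ((D 0)⁻¹ d b) * (C (D 0 c d) *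
            (X (⟨i, hi⟩, a, c) : MvPolynomial (Fin (n + 1) × Fin m × Fin m) K)) =
            C ((1 : Matrix (Fin m) (Fin m) K) c b) * X (⟨i, hi⟩, a, c) := by
          intro c
          rw [← congrFun h2 c, Matrix.mul_apply, map_sum, Finset.sum_mul]
          refine Finset.sum_congr rfl fun d _ => ?_
          rw [C_mul]
          ring
        simp only [h3, Matrix.one_apply]
        simp
      rw [hinv]
      exact sum_mem fun d _ => mul_mem (Subalgebra.algebraMap_mem _ _) (hrow d)
  rw [← AlgHom.range_eq_top, eq_top_iff, ← adjoin_range_X]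
  refine Algebra.adjoin_le ?_
  rintro _ ⟨⟨⟨i, hi⟩, a, b⟩, rfl⟩
  exact hX i hi a b

variable {δ : Derivation ℤ L L} {D : ℕ → Matrix (Fin m) (Fin m) K}

theorem derivation_iterate_mul_apply
    (hD : ∀ j a b, algebraMap K L (D (j + 1) a b) = δ (algebraMap K L (D j a b)))
    (x : Matrix (Fin m) (Fin m) L) (n : ℕ) (a b : Fin m) :
    δ^[n] ((x * (D 0).map (algebraMap K L)) a b) =
      ∑ j ∈ Finset.range (n + 1), n.choose j •
        ∑ c : Fin m, algebraMap K L (D j c b) * δ^[n - j] (x a c) := by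
  have hD' : ∀ j a b, algebraMap K L (D j a b) = δ^[j] (algebraMap K L (D 0 a b)) := by
    intro j a b
    induction j with
    | zero => rfl
    | succ j ih => rw [hD, ih, Function.iterate_succ_apply']
  have hsum : ∀ f : Fin m → L, δ^[n] (∑ c, f c) = ∑ c, δ^[n] (f c) := fun f => by
    have := map_sum ((δ : L →ₗ[ℤ] L) ^ n) f Finset.univ
    simp only [Module.End.pow_apply] at this
    exact this
  rw [Matrix.mul_apply, hsum]
  simp only [Matrix.map_apply, derivation_iterate_mul, Finset.smul_sum]
  rw [Finset.sum_comm]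
  refine Finset.sum_congr rfl fun j _ => Finset.sum_congr rfl fun c _ => ?_
  rw [hD' j c b]

theorem aeval_jetAction
    (hD : ∀ j a b, algebraMap K L (D (j + 1) a b) = δ (algebraMap K L (D j a b)))
    (x : Matrix (Fin m) (Fin m) L) (p : MvPolynomial (ℕ × Fin m × Fin m) K) :
    aeval (fun v : ℕ × Fin m × Fin m => δ^[v.1] (x v.2.1 v.2.2)) (jetAction D p) =
      aeval (fun v : ℕ × Fin m × Fin m =>
        δ^[v.1] ((x * (D 0).map (algebraMap K L)) v.2.1 v.2.2)) p := by
  rw [jetAction, comp_aeval_apply]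
  congr 2
  funext v
  rw [derivation_iterate_mul_apply hD]
  simp only [map_sum, map_nsmul, map_mul, aeval_X, algHom_C]

theorem aeval_truncJetAction
    (hD : ∀ j a b, algebraMap K L (D (j + 1) a b) = δ (algebraMap K L (D j a b)))
    (x : Matrix (Fin m) (Fin m) L) (n : ℕ) (p : MvPolynomial (Fin (n + 1) × Fin m × Fin m) K) :
    aeval (fun v : Fin (n + 1) × Fin m × Fin m => δ^[(v.1 : ℕ)] (x v.2.1 v.2.2))
        (truncJetAction n D p) =
      aeval (fun v : Fin (n + 1) × Fin m × Fin m =>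
        δ^[(v.1 : ℕ)] ((x * (D 0).map (algebraMap K L)) v.2.1 v.2.2)) p := by
  rw [truncJetAction, comp_aeval_apply]
  congr 2
  funext v
  rw [derivation_iterate_mul_apply hD]
  simp only [map_sum, map_nsmul, map_mul, aeval_X, algHom_C]

end Action

open MvPolynomial in
/-- A differential polynomial involves derivatives up to a finite order only. -/
theorem exists_rename_eq_of_order {ι R : Type*} [CommRing R] (p : MvPolynomial (ℕ × ι) R) :
    ∃ (n : ℕ) (q : MvPolynomial (Fin (n + 1) × ι) R),
      rename (fun v : Fin (n + 1) × ι => ((v.1 : ℕ), v.2)) q = p := by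
  obtain ⟨s, q, rfl⟩ := exists_finset_rename p
  refine ⟨s.sup Prod.fst, rename (fun v : {v // v ∈ s} =>
    (⟨v.1.1, Nat.lt_succ_of_le (Finset.le_sup (f := Prod.fst) v.2)⟩, v.1.2)) q, ?_⟩
  rw [rename_rename]
  rfl

theorem derivation_mem_closure_union_fixed {L : Type*} [Field L] (σ : L ≃+* L)
    (δ : Derivation ℤ L L) (hcomm : ∀ x : L, σ (δ x) = δ (σ x)) (k : Subfield L)
    (hkδ : ∀ x ∈ k, δ x ∈ k) {x : L}
    (hx : x ∈ Subfield.closure ((k : Set L) ∪ {x | σ x = x})) :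
    δ x ∈ Subfield.closure ((k : Set L) ∪ {x | σ x = x}) := by
  induction hx using Subfield.closure_induction with
  | mem x hx =>
    rcases hx with hx | hx
    · exact Subfield.subset_closure (Or.inl (hkδ x hx))
    · exact Subfield.subset_closure (Or.inr (by rw [Set.mem_ofPred_eq, hcomm, hx]))
  | one => rw [Derivation.map_one_eq_zero]; exact zero_mem _
  | add x y _ _ hx hy => rw [map_add]; exact add_mem hx hy
  | neg x _ hx => rw [map_neg]; exact neg_mem hx
  | inv x hx' hx =>
    rw [Derivation.leibniz_inv, smul_eq_mul]
    exact mul_mem (neg_mem (pow_mem (inv_mem hx') 2)) hx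
  | mul x y hx' hy' hx hy =>
    rw [Derivation.leibniz, smul_eq_mul, smul_eq_mul]
    exact add_mem (mul_mem hx' hy) (mul_mem hy' hx)

/-- A matrix `B ∈ GL_m(C_L)` (encoded by its sequence of derivatives `DB`)
lies in the differential Galois group `ℍ` (i.e. `g_B` preserves the differential
vanishing ideal `I_δ` of `X` over `kC_L`) iff for every `n` the block matrix
`(B, B', …, B⁽ⁿ⁾)` lies in the algebraic Galois group `ℍ_n` (i.e. its action preserves
the vanishing ideal `I_n` of `(X, X', …, X⁽ⁿ⁾)`); moreover, by noetherianity of the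
Kolchin topology, there is an `n₀` such that membership for all `n ≤ n₀` suffices. -/
theorem stmt12 {L : Type*} [Field L] [CharZero L]
    (σ : L ≃+* L) (δ : Derivation ℤ L L)
    (hcomm : ∀ x : L, σ (δ x) = δ (σ x))
    (k : Subfield L)
    (hkσ : ∀ x ∈ k, σ x ∈ k) (hkδ : ∀ x ∈ k, δ x ∈ k)
    (hDk : ∀ x ∈ k, (∃ p : Polynomial L, p.Monic ∧
      (∀ i, p.coeff i ∈ k ∧ σ (p.coeff i) = p.coeff i) ∧ p.eval x = 0) → σ x = x)
    {m : ℕ} (A : Matrix (Fin m) (Fin m) L) (hAk : ∀ i j, A i j ∈ k) (hA : IsUnit A.det)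
    (X : Matrix (Fin m) (Fin m) L) (hX : IsUnit X.det)
    (hσX : X.map σ = A * X)
    (hLgen : ∀ F : Subfield L, k ≤ F → (∀ i j, X i j ∈ F) →
      (∀ y ∈ F, δ y ∈ F) → F = ⊤) :
    letI kCL : Subfield L := Subfield.closure ((k : Set L) ∪ {x | σ x = x})
    -- a candidate group element: `B = DB 0 ∈ GL_m(C_L)` together with its derivatives
    letI Bcond : (ℕ → Matrix (Fin m) (Fin m) kCL) → Prop := fun DB =>
      (∀ (j : ℕ) (a b : Fin m), ((DB (j + 1) a b : L)) = δ (DB j a b)) ∧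
      (∀ a b : Fin m, σ ((DB 0 a b : L)) = (DB 0 a b : L)) ∧
      IsUnit (Matrix.of fun a b : Fin m => ((DB 0 a b : L))).det
    -- the differential vanishing ideal `I_δ` and the differential action `g_B`
    letI Iδ : Ideal (MvPolynomial (ℕ × Fin m × Fin m) kCL) :=
      RingHom.ker (MvPolynomial.aeval
        (fun v : ℕ × Fin m × Fin m =>
          ((fun M : Matrix (Fin m) (Fin m) L => M.map δ)^[v.1] X) v.2.1 v.2.2) :
        MvPolynomial (ℕ × Fin m × Fin m) kCL →ₐ[kCL] L)
    letI gB : (ℕ → Matrix (Fin m) (Fin m) kCL) →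
        MvPolynomial (ℕ × Fin m × Fin m) kCL →ₐ[kCL]
          MvPolynomial (ℕ × Fin m × Fin m) kCL := fun DB =>
      MvPolynomial.aeval (fun v : ℕ × Fin m × Fin m =>
        ∑ j ∈ Finset.range (v.1 + 1), (v.1.choose j) •
          ∑ c : Fin m, MvPolynomial.C (DB j c v.2.2) *
            MvPolynomial.X (v.1 - j, v.2.1, c))
    -- the vanishing ideal `I_n` of `(X, X', …, X⁽ⁿ⁾)` and the action of the block matrix
    letI In : (n : ℕ) → Ideal (MvPolynomial (Fin (n + 1) × Fin m × Fin m) kCL) := fun n =>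
      RingHom.ker (MvPolynomial.aeval
        (fun v : Fin (n + 1) × Fin m × Fin m =>
          ((fun M : Matrix (Fin m) (Fin m) L => M.map δ)^[(v.1 : ℕ)] X) v.2.1 v.2.2) :
        MvPolynomial (Fin (n + 1) × Fin m × Fin m) kCL →ₐ[kCL] L)
    letI gn : (n : ℕ) → (ℕ → Matrix (Fin m) (Fin m) kCL) →
        MvPolynomial (Fin (n + 1) × Fin m × Fin m) kCL →ₐ[kCL]
          MvPolynomial (Fin (n + 1) × Fin m × Fin m) kCL := fun n DB =>
      MvPolynomial.aeval (fun v : Fin (n + 1) × Fin m × Fin m =>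
        ∑ j ∈ Finset.range ((v.1 : ℕ) + 1), ((v.1 : ℕ).choose j) •
          ∑ c : Fin m, (MvPolynomial.C (DB j c v.2.2) :
              MvPolynomial (Fin (n + 1) × Fin m × Fin m) kCL) *
            MvPolynomial.X
              (Fin.mk ((v.1 : ℕ) - j) (Nat.lt_of_le_of_lt (Nat.sub_le _ _) v.1.isLt),
                v.2.1, c))
    -- first equivalence, and the noetherianity bound `n₀`
    (∀ DB : ℕ → Matrix (Fin m) (Fin m) kCL, Bcond DB →
      ((∀ p ∈ Iδ, gB DB p ∈ Iδ) ↔ ∀ n : ℕ, ∀ p ∈ In n, gn n DB p ∈ In n)) ∧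
    (∃ n₀ : ℕ, ∀ DB : ℕ → Matrix (Fin m) (Fin m) kCL, Bcond DB →
      ((∀ p ∈ Iδ, gB DB p ∈ Iδ) ↔ ∀ n ≤ n₀, ∀ p ∈ In n, gn n DB p ∈ In n)) := by
  simp only [RingHom.mem_ker, iterate_matrix_map_apply]
  set K : Subfield L := Subfield.closure ((k : Set L) ∪ {x | σ x = x})
  have hK : ∀ c : K, ∃ d : K, δ (algebraMap K L c) = algebraMap K L d := fun c =>
    ⟨⟨δ c, derivation_mem_closure_union_fixed σ δ hcomm k hkδ c.2⟩, rfl⟩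
  have hδ := fun (D : ℕ → Matrix (Fin m) (Fin m) K)
      (hD : ∀ j a b, algebraMap K L (D (j + 1) a b) = δ (algebraMap K L (D j a b))) =>
    aeval_jetAction hD X
  have hn := fun (D : ℕ → Matrix (Fin m) (Fin m) K)
      (hD : ∀ j a b, algebraMap K L (D (j + 1) a b) = δ (algebraMap K L (D j a b))) =>
    aeval_truncJetAction hD X
  unfold jetAction at hδ
  unfold truncJetAction at hn
  have hfirst := fun (D : ℕ → Matrix (Fin m) (Fin m) K)
      (hD : ∀ j a b, algebraMap K L (D (j + 1) a b) = δ (algebraMap K L (D j a b)))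
      (h : ∀ p : MvPolynomial (ℕ × Fin m × Fin m) K, MvPolynomial.aeval
        (fun v : ℕ × Fin m × Fin m => δ^[v.1] (X v.2.1 v.2.2)) p = 0 →
        MvPolynomial.aeval (fun v : ℕ × Fin m × Fin m =>
          δ^[v.1] ((X * (D 0).map (algebraMap K L)) v.2.1 v.2.2)) p = 0)
      (n : ℕ) (p : MvPolynomial (Fin (n + 1) × Fin m × Fin m) K)
      (hp : MvPolynomial.aeval
        (fun v : Fin (n + 1) × Fin m × Fin m => δ^[(v.1 : ℕ)] (X v.2.1 v.2.2)) p = 0) => by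
    have := h (MvPolynomial.rename (fun v => ((v.1 : ℕ), v.2)) p)
    rw [MvPolynomial.aeval_rename, MvPolynomial.aeval_rename] at this
    exact this hp
  refine ⟨fun D ⟨hD, _, _⟩ => ?_, ?_⟩
  · simp only [hδ D hD, hn D hD]
    refine ⟨hfirst D hD, fun h p hp => ?_⟩
    obtain ⟨n, q, rfl⟩ := exists_rename_eq_of_order p
    rw [MvPolynomial.aeval_rename] at hp ⊢
    exact h n q hp
  · obtain ⟨N, hN⟩ := exists_order_forall_aeval_eq_zero δ hK
      (fun v : Fin m × Fin m => X v.1 v.2)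
    refine ⟨N, fun D ⟨hD, _, hdet⟩ => ?_⟩
    simp only [hδ D hD, hn D hD]
    refine ⟨fun h n _ => hfirst D hD h n, fun h => ?_⟩
    refine hN (fun v => (X * (D 0).map (algebraMap K L)) v.1 v.2) fun p =>
      ⟨h N le_rfl p, fun hp => ?_⟩
    have hdet' : IsUnit (D 0).det := by
      rw [isUnit_iff_ne_zero] at hdet ⊢
      intro h0
      refine hdet ?_
      have := (algebraMap K L).map_det (D 0)
      rw [h0, map_zero] at this
      exact this.symm
    refine comap_le_of_le_comap_of_surjective (truncJetAction N D : _ →+* _)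
      (truncJetAction_surjective N D hdet')
      (I := RingHom.ker (MvPolynomial.aeval (R := K)
        (fun v : Fin (N + 1) × Fin m × Fin m => δ^[(v.1 : ℕ)] (X v.2.1 v.2.2))))
      (fun q hq => ?_) ?_
    · exact (aeval_truncJetAction hD X N q).trans (h N le_rfl q hq)
    · exact (aeval_truncJetAction hD X N p).trans hp
end
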